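/- For every dimension d ≥ 1 and every ε > 0, for Lebesgue-almost every α = (α_1,…,α_d) ∈ [0,1)^d there exists a constant C = C(α,d,ε) > 0 such that the discrepancy D_N of the Kronecker sequence z_n = ({nα_1},…,{nα_d}), n ≥ 0, satisfies D_N ≤ C · (log N)^d (log log N)^{1+ε} / N for all N ≥ 3. -/

import Mathlib

open MeasureTheory Real

/-- The (extreme) discrepancy of the first `N` points of a sequence `z` in `[0,1)^ι`:
the supremum over all axis-parallel boxes `∏ [u i, v i) ⊆ [0,1)^ι` of
`|A_N(B)/N - λ(B)|`. -/
noncomputable def disc {ι : Type*} [Fintype ι] (z : ℕ → ι → ℝ) (N : ℕ) : ℝ :=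
  sSup { r : ℝ | ∃ u v : ι → ℝ,
    (∀ i, 0 ≤ u i ∧ u i ≤ v i ∧ v i ≤ 1) ∧
    r = |(Nat.card {n : ℕ // n < N ∧ ∀ i, u i ≤ z n i ∧ z n i < v i} : ℝ) / N
          - ∏ i, (v i - u i)| }

namespace KroneckerDisc

theorem coe_intCast_eq_zero (m : ℤ) : ((m : ℝ) : UnitAddCircle) = 0 := by
  rw [AddCircle.coe_eq_zero_iff]
  exact ⟨m, by simp⟩

theorem coe_fract (y : ℝ) : ((Int.fract y : ℝ) : UnitAddCircle) = (y : UnitAddCircle) := by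
  rw [Int.fract, AddCircle.coe_sub, coe_intCast_eq_zero, sub_zero]

theorem norm_coe_le_one_sub_fract (y : ℝ) : ‖(y : UnitAddCircle)‖ ≤ 1 - Int.fract y := by
  rw [UnitAddCircle.norm_eq]
  refine (round_le y (⌊y⌋ + 1)).trans ?_
  have := Int.fract_lt_one y
  rw [abs_le]
  unfold Int.fract at *
  push_cast
  constructor <;> linarith

theorem norm_coe_le_half (y : UnitAddCircle) : ‖y‖ ≤ 1 / 2 := by
  simpa using AddCircle.norm_le_half_period 1 (x := y) one_ne_zero

/-- The periodic second Bernoulli function. -/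
noncomputable def bern (y : ℝ) : ℝ := Int.fract y ^ 2 - Int.fract y + 1 / 6

theorem hasSum_bern (y : ℝ) :
    HasSum (fun k : ℤ => 1 / (k : ℂ) ^ 2 * fourier k (y : UnitAddCircle))
      ((2 * π ^ 2 * bern y : ℝ) : ℂ) := by
  have h := hasSum_one_div_pow_mul_fourier_mul_bernoulliFun (k := 2) le_rfl
    (x := Int.fract y) ⟨Int.fract_nonneg y, (Int.fract_lt_one y).le⟩
  rw [coe_fract] at h
  convert h using 1
  rw [bernoulliFun_two, bern]
  push_cast
  rw [mul_pow, mul_pow, Complex.I_sq]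
  rw [show ((Nat.factorial 2 : ℕ) : ℂ) = 2 by norm_num [Nat.factorial]]
  ring

/-- The mean of the sawtooth function `fract - 1/2` over `[y, y + δ]`. -/
noncomputable def smoothSaw (δ y : ℝ) : ℝ := (bern (y + δ) - bern y) / (2 * δ)

theorem fract_add_of_lt {y δ : ℝ} (hδ : 0 ≤ δ) (h : Int.fract y + δ < 1) :
    Int.fract (y + δ) = Int.fract y + δ := by
  rw [Int.fract_eq_iff]
  refine ⟨by have := Int.fract_nonneg y; linarith, h, ⌊y⌋, ?_⟩
  unfold Int.fract; ring

theorem fract_add_of_ge {y δ : ℝ} (hδ : δ ≤ 1) (h : 1 ≤ Int.fract y + δ) :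
    Int.fract (y + δ) = Int.fract y + δ - 1 := by
  rw [Int.fract_eq_iff]
  refine ⟨by linarith, by have := Int.fract_lt_one y; linarith, ⌊y⌋ + 1, ?_⟩
  unfold Int.fract; push_cast; ring

theorem abs_smoothSaw_le {δ : ℝ} (h0 : 0 < δ) (h1 : δ ≤ 1) (y : ℝ) : |smoothSaw δ y| ≤ 1 / 2 := by
  have hy0 := Int.fract_nonneg y
  have hy1 := Int.fract_lt_one y
  unfold smoothSaw bern
  rw [abs_div, abs_of_pos (by linarith : 0 < 2 * δ), div_le_iff₀ (by linarith), abs_le]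
  rcases lt_or_ge (Int.fract y + δ) 1 with h | h
  · rw [fract_add_of_lt h0.le h]
    constructor <;> nlinarith
  · rw [fract_add_of_ge h1 h]
    constructor <;> nlinarith [mul_nonneg (sub_nonneg.2 h1) (sub_nonneg.2 h),
      mul_nonneg (sub_nonneg.2 h1) (sub_nonneg.2 hy1.le)]

theorem smoothSaw_of_lt {δ y : ℝ} (h0 : 0 < δ) (h : Int.fract y + δ < 1) :
    smoothSaw δ y = Int.fract y - 1 / 2 + δ / 2 := by
  unfold smoothSaw bern
  rw [fract_add_of_lt h0.le h]
  field_simp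
  ring

theorem smoothSaw_one (y : ℝ) : smoothSaw 1 y = 0 := by
  simp [smoothSaw, bern]

theorem smoothSaw_eq_of_norm_lt {δ y : ℝ} (h0 : 0 < δ) (h : δ < ‖(y : UnitAddCircle)‖) :
    smoothSaw δ y = Int.fract y - 1 / 2 + δ / 2 :=
  smoothSaw_of_lt h0 (by have := norm_coe_le_one_sub_fract y; linarith)

/-- Fourier coefficients of `smoothSaw δ - smoothSaw (2 * δ)`. -/
noncomputable def sawCoeff (δ : ℝ) (k : ℤ) : ℂ :=
  -(fourier k (δ : UnitAddCircle) - 1) ^ 2 / (8 * π ^ 2 * δ * k ^ 2)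

theorem hasSum_sawStep {δ : ℝ} (h0 : 0 < δ) (y : ℝ) :
    HasSum (fun k : ℤ => sawCoeff δ k * fourier k (y : UnitAddCircle))
      ((smoothSaw δ y - smoothSaw (2 * δ) y : ℝ) : ℂ) := by
  have h := (((hasSum_bern (y + 2 * δ)).sub ((hasSum_bern (y + δ)).mul_left 2)).add
    (hasSum_bern y)).mul_left (-1 / (8 * π ^ 2 * δ : ℂ))
  have hfun : (fun k : ℤ => sawCoeff δ k * fourier k (y : UnitAddCircle)) = fun k : ℤ =>
      -1 / (8 * π ^ 2 * δ : ℂ) * (1 / (k : ℂ) ^ 2 * fourier k ((y + 2 * δ : ℝ) : UnitAddCircle)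
        - 2 * (1 / (k : ℂ) ^ 2 * fourier k ((y + δ : ℝ) : UnitAddCircle))
        + 1 / (k : ℂ) ^ 2 * fourier k (y : UnitAddCircle)) := by
    funext k
    have e1 : fourier k ((y + δ : ℝ) : UnitAddCircle)
        = fourier k (y : UnitAddCircle) * fourier k (δ : UnitAddCircle) := by
      simp [fourier_apply, AddCircle.toCircle_add]
    have e2 : fourier k ((y + 2 * δ : ℝ) : UnitAddCircle)
        = fourier k (y : UnitAddCircle) * fourier k (δ : UnitAddCircle) ^ 2 := by
      rw [two_mul]
      simp [fourier_apply, AddCircle.toCircle_add, sq]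
    rw [e1, e2, sawCoeff, div_eq_mul_inv, div_eq_mul_inv, mul_inv, one_div]
    ring
  have hval : ((smoothSaw δ y - smoothSaw (2 * δ) y : ℝ) : ℂ) = -1 / (8 * π ^ 2 * δ : ℂ) *
      (((2 * π ^ 2 * bern (y + 2 * δ) : ℝ) : ℂ) - 2 * ((2 * π ^ 2 * bern (y + δ) : ℝ) : ℂ)
        + ((2 * π ^ 2 * bern y : ℝ) : ℂ)) := by
    have : (δ : ℂ) ≠ 0 := by exact_mod_cast h0.ne'
    have hpi : (π : ℂ) ≠ 0 := by exact_mod_cast pi_ne_zero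
    unfold smoothSaw
    push_cast
    field_simp
    ring
  rw [hfun, hval]
  exact h

theorem norm_fourier_sub_one_le (k : ℤ) (δ : ℝ) :
    ‖fourier k (δ : UnitAddCircle) - 1‖ ≤ 2 * π * |(k : ℝ)| * |δ| := by
  have e : (fourier k (δ : UnitAddCircle) : ℂ) = Complex.exp (Complex.I * ((2 * π * k * δ : ℝ))) := by
    rw [fourier_coe_apply]
    congr 1; push_cast; ring
  rw [e]
  refine (norm_exp_I_mul_ofReal_sub_one_le).trans ?_
  simp [abs_of_pos pi_pos]

theorem norm_sawCoeff_le {δ : ℝ} (h0 : 0 < δ) (k : ℤ) : ‖sawCoeff δ k‖ ≤ δ / 2 := by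
  by_cases hk : k = 0
  · simp [sawCoeff, hk]; positivity
  have hk' : 0 < |(k : ℝ)| := by positivity
  have h := norm_fourier_sub_one_le k δ
  rw [abs_of_pos h0] at h
  rw [sawCoeff, norm_div, norm_neg, norm_pow]
  have e : ‖(8 * π ^ 2 * δ * k ^ 2 : ℂ)‖ = 8 * π ^ 2 * δ * |(k : ℝ)| ^ 2 := by
    simp [abs_of_pos pi_pos, abs_of_pos h0]
  rw [e, div_le_iff₀ (by positivity)]
  calc _ ≤ (2 * π * |(k : ℝ)| * δ) ^ 2 := by gcongr
    _ = _ := by ring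

theorem norm_sawCoeff_le' {δ : ℝ} (h0 : 0 < δ) (k : ℤ) : ‖sawCoeff δ k‖ ≤ 1 / (4 * δ * k ^ 2) := by
  by_cases hk : k = 0
  · simp [sawCoeff, hk]
  have hk' : 0 < |(k : ℝ)| := by positivity
  have h : ‖fourier k (δ : UnitAddCircle) - 1‖ ≤ 2 := by
    refine (norm_sub_le _ _).trans ?_
    rw [norm_one, fourier_apply, Circle.norm_coe]; norm_num
  rw [sawCoeff, norm_div, norm_neg, norm_pow]
  have e : ‖(8 * π ^ 2 * δ * k ^ 2 : ℂ)‖ = 8 * π ^ 2 * δ * |(k : ℝ)| ^ 2 := by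
    simp [abs_of_pos pi_pos, abs_of_pos h0]
  have hpi : 2 ≤ π := two_le_pi
  rw [e, sq_abs, div_le_div_iff₀ (by positivity) (by positivity), one_mul]
  calc _ ≤ 2 ^ 2 * (4 * δ * (k : ℝ) ^ 2) := by gcongr
    _ ≤ 8 * 2 ^ 2 * δ * (k : ℝ) ^ 2 := by
      nlinarith [show 0 ≤ δ * (k : ℝ) ^ 2 by positivity]
    _ ≤ _ := by gcongr

theorem indicator_eq_saw {u v : ℝ} (hu : 0 ≤ u) (huv : u ≤ v) (hv : v ≤ 1) (y : ℝ) :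
    (if u ≤ Int.fract y ∧ Int.fract y < v then (1 : ℝ) else 0)
      = (v - u) + Int.fract (y - v) - Int.fract (y - u) := by
  have hy0 := Int.fract_nonneg y
  have hy1 := Int.fract_lt_one y
  have key : ∀ w : ℝ, 0 ≤ w → w ≤ 1 → Int.fract (y - w)
      = Int.fract y - w + if w ≤ Int.fract y then 0 else 1 := by
    intro w hw0 hw1
    rw [Int.fract_eq_iff]
    split_ifs with h
    · exact ⟨by linarith, by linarith, ⌊y⌋, by unfold Int.fract; ring⟩
    · push Not at h
      exact ⟨by linarith, by linarith, ⌊y⌋ - 1, by unfold Int.fract; push_cast; ring⟩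
  rw [key u hu (huv.trans hv), key v (hu.trans huv) hv]
  by_cases h1 : u ≤ Int.fract y <;> by_cases h2 : Int.fract y < v
  · simp [h1, h2, not_le.2 h2]; ring
  · simp [h1, h2, not_lt.1 h2]
  · simp [h1, h2, not_le.2 h2]; ring
  · exact absurd (huv.trans (not_lt.1 h2)) h1

theorem tail_sum_le (H M : ℕ) (hH : 0 < H) :
    ∑ k ∈ (Finset.Icc (-(M : ℤ)) M) \ Finset.Icc (-(H : ℤ)) H, 1 / (k : ℝ) ^ 2
      ≤ 2 / (H : ℝ) := by
  have hsub : (Finset.Icc (-(M : ℤ)) M) \ Finset.Icc (-(H : ℤ)) H ⊆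
      (Finset.Ioc H M).image (fun i : ℕ => (i : ℤ)) ∪
        (Finset.Ioc H M).image (fun i : ℕ => -(i : ℤ)) := by
    intro k hk
    simp only [Finset.mem_sdiff, Finset.mem_Icc, not_and, not_le, Finset.mem_union,
      Finset.mem_image, Finset.mem_Ioc] at hk ⊢
    rcases le_total 0 k with h | h
    · exact Or.inl ⟨k.natAbs, by omega, by omega⟩
    · exact Or.inr ⟨k.natAbs, by omega, by omega⟩
  have hs : ∑ i ∈ Finset.Ioc H M, 1 / (i : ℝ) ^ 2 ≤ 1 / (H : ℝ) := by
    rcases le_total H M with h | h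
    · have := sum_Ioc_inv_sq_le_sub (α := ℝ) hH.ne' h
      simp only [one_div]
      have h2 : (0 : ℝ) ≤ (M : ℝ)⁻¹ := by positivity
      linarith
    · rw [Finset.Ioc_eq_empty (by omega)]; simp
  refine (Finset.sum_le_sum_of_subset_of_nonneg hsub (fun _ _ _ => by positivity)).trans ?_
  refine (le_of_le_of_eq (le_add_of_nonneg_right (Finset.sum_nonneg fun _ _ => by positivity))
    Finset.sum_union_inter).trans ?_
  rw [Finset.sum_image (by intro a _ b _ h; simpa using h),
    Finset.sum_image (by intro a _ b _ h; simpa using h)]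
  simp only [Int.cast_neg, Int.cast_natCast, neg_sq]
  calc _ ≤ 1 / (H : ℝ) + 1 / H := add_le_add hs hs
    _ = _ := by ring

theorem tail_sum_finset_le (s : Finset ℤ) (H : ℕ) (hH : 0 < H) :
    ∑ k ∈ s \ Finset.Icc (-(H : ℤ)) H, 1 / (k : ℝ) ^ 2 ≤ 2 / (H : ℝ) := by
  refine (Finset.sum_le_sum_of_subset_of_nonneg (Finset.sdiff_subset_sdiff ?_ subset_rfl)
    (fun _ _ _ => by positivity)).trans (tail_sum_le H (s.sup Int.natAbs) hH)
  intro k hk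
  have := Finset.le_sup (f := Int.natAbs) hk
  rw [Finset.mem_Icc]
  omega

/-- The part at dyadic scale `l` of the sawtooth function; the last part, `l = n`, is whatever
remains of it. -/
noncomputable def sawPiece (n l : ℕ) (y : ℝ) : ℝ :=
  if l < n then smoothSaw ((1 / 2) ^ (l + 1)) y - smoothSaw ((1 / 2) ^ l) y
  else Int.fract y - 1 / 2 - smoothSaw ((1 / 2) ^ n) y

/-- The part at dyadic scale `l` of the indicator function of `[u, v)` modulo one. -/
noncomputable def piece (n : ℕ) (u v : ℝ) (l : ℕ) (y : ℝ) : ℝ :=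
  (if l = 0 then v - u else 0) + (sawPiece n l (y - v) - sawPiece n l (y - u))

/-- Fourier coefficients of `piece n u v l` for `l < n`. -/
noncomputable def pieceCoeff (u v : ℝ) (l : ℕ) (k : ℤ) : ℂ :=
  (if l = 0 ∧ k = 0 then ((v - u : ℝ) : ℂ) else 0) + sawCoeff ((1 / 2) ^ (l + 1)) k *
    (fourier k ((-v : ℝ) : UnitAddCircle) - fourier k ((-u : ℝ) : UnitAddCircle))

theorem sum_sawPiece (n : ℕ) (y : ℝ) :
    ∑ l ∈ Finset.range (n + 1), sawPiece n l y = Int.fract y - 1 / 2 := by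
  rw [Finset.sum_range_succ]
  have : ∑ l ∈ Finset.range n, sawPiece n l y = smoothSaw ((1 / 2) ^ n) y := by
    have h := Finset.sum_range_sub (fun l => smoothSaw ((1 / 2 : ℝ) ^ l) y) n
    simp only [pow_zero, smoothSaw_one, sub_zero] at h
    rw [← h]
    refine Finset.sum_congr rfl fun l hl => ?_
    rw [sawPiece, if_pos (Finset.mem_range.1 hl)]
  rw [this, sawPiece, if_neg (lt_irrefl n)]
  ring

theorem sum_piece (n : ℕ) {u v : ℝ} (hu : 0 ≤ u) (huv : u ≤ v) (hv : v ≤ 1) (y : ℝ) :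
    ∑ l ∈ Finset.range (n + 1), piece n u v l y
      = if u ≤ Int.fract y ∧ Int.fract y < v then (1 : ℝ) else 0 := by
  rw [indicator_eq_saw hu huv hv]
  simp only [piece, Finset.sum_add_distrib, Finset.sum_sub_distrib, sum_sawPiece]
  simp
  ring

theorem abs_sawPiece_le (n l : ℕ) (y : ℝ) : |sawPiece n l y| ≤ 1 := by
  have h := fun m : ℕ => abs_le.1 (abs_smoothSaw_le (δ := (1 / 2) ^ m) (by positivity)
    (pow_le_one₀ (by norm_num) (by norm_num)) y)
  have hy0 := Int.fract_nonneg y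
  have hy1 := Int.fract_lt_one y
  rw [abs_le]
  unfold sawPiece
  split_ifs
  · have h1 := h l
    have h2 := h (l + 1)
    constructor <;> linarith
  · have h1 := h n
    constructor <;> linarith

theorem abs_piece_le (n l : ℕ) {u v : ℝ} (hu : 0 ≤ u) (huv : u ≤ v) (hv : v ≤ 1) (y : ℝ) :
    |piece n u v l y| ≤ 3 := by
  have h1 := abs_le.1 (abs_sawPiece_le n l (y - v))
  have h2 := abs_le.1 (abs_sawPiece_le n l (y - u))
  rw [abs_le]
  unfold piece
  split_ifs <;> constructor <;> linarith

theorem sawPiece_of_norm {n l : ℕ} (hl : l ≤ n) {y : ℝ} (h : (1 / 2 : ℝ) ^ l < ‖(y : UnitAddCircle)‖) :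
    sawPiece n l y = -(if l < n then (1 / 2) ^ (l + 1) else (1 / 2) ^ n) / 2 := by
  unfold sawPiece
  split_ifs with hn
  · have h' : (1 / 2 : ℝ) ^ (l + 1) < ‖(y : UnitAddCircle)‖ := by
      refine lt_of_le_of_lt ?_ h
      exact pow_le_pow_of_le_one (by norm_num) (by norm_num) (by omega)
    rw [smoothSaw_eq_of_norm_lt (by positivity) h, smoothSaw_eq_of_norm_lt (by positivity) h']
    ring
  · obtain rfl : l = n := by omega
    rw [smoothSaw_eq_of_norm_lt (by positivity) h]
    ring

theorem norm_le_of_piece_ne_zero {n l : ℕ} (hl : l ≤ n) {u v y : ℝ} (h : piece n u v l y ≠ 0) :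
    ‖((y - u : ℝ) : UnitAddCircle)‖ ≤ (1 / 2) ^ l ∨ ‖((y - v : ℝ) : UnitAddCircle)‖ ≤ (1 / 2) ^ l := by
  by_contra hcon
  push Not at hcon
  apply h
  have hl0 : l ≠ 0 := by
    rintro rfl
    have := norm_coe_le_half ((y - u : ℝ) : UnitAddCircle)
    have h1 := hcon.1
    norm_num at h1
    linarith
  rw [piece, sawPiece_of_norm hl hcon.1, sawPiece_of_norm hl hcon.2, if_neg hl0]
  ring

theorem norm_fourier_apply (k : ℤ) (x : UnitAddCircle) : ‖(fourier k x : ℂ)‖ = 1 := by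
  rw [fourier_apply, Circle.norm_coe]

theorem norm_fourier_sub_le (k : ℤ) (x y : UnitAddCircle) :
    ‖(fourier k x : ℂ) - fourier k y‖ ≤ 2 := by
  refine (norm_sub_le _ _).trans ?_
  rw [norm_fourier_apply, norm_fourier_apply]; norm_num

theorem pieceCoeff_zero (u v : ℝ) (l : ℕ) :
    pieceCoeff u v l 0 = if l = 0 then ((v - u : ℝ) : ℂ) else 0 := by
  simp [pieceCoeff]

theorem norm_pieceCoeff_le {u v : ℝ} (hu : 0 ≤ u) (huv : u ≤ v) (hv : v ≤ 1) (l : ℕ) (k : ℤ) :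
    ‖pieceCoeff u v l k‖ ≤ (1 / 2) ^ l := by
  by_cases hk : k = 0
  · rw [hk, pieceCoeff_zero]
    split_ifs with h
    · rw [h, Complex.norm_real, Real.norm_eq_abs, abs_of_nonneg (by linarith)]
      simp; linarith
    · simp
  · rw [pieceCoeff, if_neg (by tauto), zero_add, norm_mul]
    calc _ ≤ ((1 / 2 : ℝ) ^ (l + 1) / 2) * 2 := by
          gcongr
          · exact norm_sawCoeff_le (by positivity) k
          · exact norm_fourier_sub_le _ _ _
      _ ≤ (1 / 2) ^ l := by
          rw [pow_succ]; nlinarith [show (0 : ℝ) < (1 / 2) ^ l by positivity]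

theorem norm_pieceCoeff_le' (u v : ℝ) (l : ℕ) {k : ℤ} (hk : k ≠ 0) :
    ‖pieceCoeff u v l k‖ ≤ 2 ^ l / k ^ 2 := by
  rw [pieceCoeff, if_neg (by tauto), zero_add, norm_mul]
  have hk' : (k : ℝ) ≠ 0 := by exact_mod_cast hk
  calc _ ≤ (1 / (4 * (1 / 2 : ℝ) ^ (l + 1) * k ^ 2)) * 2 := by
        gcongr
        · exact norm_sawCoeff_le' (by positivity) k
        · exact norm_fourier_sub_le _ _ _
    _ = 2 ^ l / k ^ 2 := by
        rw [pow_succ, one_div_pow]; field_simp; norm_num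

theorem hasSum_piece {n l : ℕ} (hl : l < n) (u v y : ℝ) :
    HasSum (fun k : ℤ => pieceCoeff u v l k * fourier k (y : UnitAddCircle))
      ((piece n u v l y : ℝ) : ℂ) := by
  have h1 := hasSum_sawStep (δ := (1 / 2) ^ (l + 1)) (by positivity) (y - v)
  have h2 := hasSum_sawStep (δ := (1 / 2) ^ (l + 1)) (by positivity) (y - u)
  have h3 : HasSum (fun k : ℤ => if k = 0 then ((if l = 0 then v - u else 0 : ℝ) : ℂ) else 0)
      ((if l = 0 then v - u else 0 : ℝ) : ℂ) :=
    hasSum_ite_eq 0 _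
  have e : 2 * (1 / 2 : ℝ) ^ (l + 1) = (1 / 2) ^ l := by rw [pow_succ]; ring
  rw [e] at h1 h2
  have h := h3.add (h1.sub h2)
  have hval : ((piece n u v l y : ℝ) : ℂ) = ((if l = 0 then v - u else 0 : ℝ) : ℂ) +
      (((smoothSaw ((1 / 2) ^ (l + 1)) (y - v) - smoothSaw ((1 / 2) ^ l) (y - v) : ℝ) : ℂ) -
       ((smoothSaw ((1 / 2) ^ (l + 1)) (y - u) - smoothSaw ((1 / 2) ^ l) (y - u) : ℝ) : ℂ)) := by
    rw [piece, sawPiece, sawPiece, if_pos hl, if_pos hl]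
    push_cast
    ring
  rw [hval]
  refine h.congr_fun ?_
  intro k
  have e1 : ∀ w : ℝ, (fourier k ((y - w : ℝ) : UnitAddCircle) : ℂ)
      = fourier k (y : UnitAddCircle) * fourier k ((-w : ℝ) : UnitAddCircle) := by
    intro w
    rw [sub_eq_add_neg]
    simp [fourier_apply, AddCircle.toCircle_add]
  rw [e1, e1, pieceCoeff]
  by_cases hk : k = 0 <;> by_cases hl0 : l = 0 <;> simp [hk, hl0] <;> ring

theorem abs_piece_sub_sum_le {n l : ℕ} (hl : l < n) (u v y : ℝ) {H : ℕ} (hH : 0 < H) :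
    ‖((piece n u v l y : ℝ) : ℂ)
      - ∑ k ∈ Finset.Icc (-(H : ℤ)) H, pieceCoeff u v l k * fourier k (y : UnitAddCircle)‖
      ≤ 2 ^ l * (2 / H) := by
  have h := hasSum_piece hl u v y
  have hlim := (Filter.Tendsto.sub_const h
    (∑ k ∈ Finset.Icc (-(H : ℤ)) H, pieceCoeff u v l k * fourier k (y : UnitAddCircle))).norm
  refine le_of_tendsto hlim ?_
  filter_upwards [Filter.eventually_ge_atTop (Finset.Icc (-(H : ℤ)) H)] with s hs
  rw [← Finset.sum_sdiff hs, add_sub_cancel_right]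
  calc _ ≤ ∑ k ∈ s \ Finset.Icc (-(H : ℤ)) H, 2 ^ l * (1 / (k : ℝ) ^ 2) := by
        refine norm_sum_le_of_le _ fun k hk => ?_
        rw [norm_mul, norm_fourier_apply, mul_one, mul_one_div]
        refine norm_pieceCoeff_le' u v l ?_
        rintro rfl
        simp at hk
    _ ≤ _ := by
        rw [← Finset.mul_sum]
        gcongr
        exact tail_sum_finset_le s H hH

/-- The number of `q ∈ (-M, M)` for which every `q • x i` is within `2 * 2 ^ (-l i)` of zero. -/
noncomputable def closeCount {d : ℕ} (x : Fin d → UnitAddCircle) (M : ℕ) (l : Fin d → ℕ) : ℕ :=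
  ((Finset.Ioo (-(M : ℤ)) M).filter fun q => ∀ i, ‖q • x i‖ ≤ 2 * (1 / 2) ^ l i).card

/-- The product over the coordinates of the dyadic pieces of a box. -/
noncomputable def boxPiece {d : ℕ} (n : ℕ) (α u v : Fin d → ℝ) (l : Fin d → ℕ) (q : ℕ) : ℝ :=
  ∏ i, piece n (u i) (v i) (l i) (q * α i)

theorem one_le_closeCount {d : ℕ} (x : Fin d → UnitAddCircle) {M : ℕ} (hM : 0 < M)
    (l : Fin d → ℕ) : 1 ≤ closeCount x M l := by
  rw [closeCount, Nat.one_le_iff_ne_zero, ← Nat.pos_iff_ne_zero, Finset.card_pos]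
  refine ⟨0, ?_⟩
  simp [hM]

theorem norm_sub_smul_le {a w : ℝ} {p q : ℕ} {δ : ℝ}
    (hp : ‖((p * a - w : ℝ) : UnitAddCircle)‖ ≤ δ) (hq : ‖((q * a - w : ℝ) : UnitAddCircle)‖ ≤ δ) :
    ‖((p : ℤ) - q) • (a : UnitAddCircle)‖ ≤ 2 * δ := by
  have e : ((p : ℤ) - q) • (a : UnitAddCircle)
      = ((p * a - w : ℝ) : UnitAddCircle) - ((q * a - w : ℝ) : UnitAddCircle) := by
    rw [← AddCircle.coe_sub, ← AddCircle.coe_zsmul]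
    congr 1
    simp [sub_mul]
  rw [e]
  refine (norm_sub_le _ _).trans ?_
  linarith

theorem card_filter_boxPiece_le {d n : ℕ} (α u v : Fin d → ℝ) (l : Fin d → ℕ)
    (hl : ∀ i, l i ≤ n) (a M : ℕ) (s : Finset ℕ) (hs : s ⊆ Finset.Ico a (a + M)) :
    (s.filter fun q => boxPiece n α u v l q ≠ 0).card
      ≤ 2 ^ d * closeCount (fun i => (α i : UnitAddCircle)) M l := by
  classical
  set f : ℕ → (Fin d → Bool) := fun q i =>
    decide (‖((q * α i - u i : ℝ) : UnitAddCircle)‖ ≤ (1 / 2) ^ l i) with hf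
  refine (Finset.card_le_mul_card_image (f := f) _ (closeCount (fun i => (α i : UnitAddCircle)) M l)
    ?_).trans ?_
  · intro b hb
    obtain ⟨q₀, hq₀, rfl⟩ := Finset.mem_image.1 hb
    refine Finset.card_le_card_of_injOn (fun q : ℕ => (q : ℤ) - q₀) ?_ ?_
    · intro q hq
      simp only [Finset.coe_filter, Finset.mem_filter, Set.mem_ofPred_eq] at hq
      obtain ⟨⟨hqs, hq1⟩, hqf⟩ := hq
      obtain ⟨hq0s, hq01⟩ := Finset.mem_filter.1 hq₀
      have h1 := Finset.mem_Ico.1 (hs hqs)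
      have h2 := Finset.mem_Ico.1 (hs hq0s)
      simp only [Finset.coe_filter, Finset.mem_Ioo, Set.mem_ofPred_eq]
      refine ⟨⟨by omega, by omega⟩, fun i => ?_⟩
      have hfi := congrFun hqf i
      simp only [hf, decide_eq_decide] at hfi
      have p1 := norm_le_of_piece_ne_zero (hl i) ((Finset.prod_ne_zero_iff.1 hq1) i (Finset.mem_univ i))
      have p2 := norm_le_of_piece_ne_zero (hl i)
        ((Finset.prod_ne_zero_iff.1 hq01) i (Finset.mem_univ i))
      by_cases hc : ‖((q * α i - u i : ℝ) : UnitAddCircle)‖ ≤ (1 / 2) ^ l i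
      · exact norm_sub_smul_le hc (hfi.1 hc)
      · exact norm_sub_smul_le (p1.resolve_left hc) (p2.resolve_left (fun h => hc (hfi.2 h)))
    · intro p _ q _ h
      simpa using h
  · rw [mul_comm]
    gcongr
    refine (Finset.card_le_univ _).trans ?_
    simp

theorem abs_boxPiece_le {d n : ℕ} (α : Fin d → ℝ) {u v : Fin d → ℝ}
    (hb : ∀ i, 0 ≤ u i ∧ u i ≤ v i ∧ v i ≤ 1) (l : Fin d → ℕ) (q : ℕ) :
    |boxPiece n α u v l q| ≤ 3 ^ d := by
  rw [boxPiece, Finset.abs_prod]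
  refine (Finset.prod_le_prod (fun i _ => abs_nonneg _) fun i _ =>
    abs_piece_le n (l i) (hb i).1 (hb i).2.1 (hb i).2.2 _).trans ?_
  simp

theorem abs_sum_boxPiece_le {d n : ℕ} (α : Fin d → ℝ) {u v : Fin d → ℝ}
    (hb : ∀ i, 0 ≤ u i ∧ u i ≤ v i ∧ v i ≤ 1) (l : Fin d → ℕ)
    (hl : ∀ i, l i ≤ n) (a M : ℕ) (s : Finset ℕ) (hs : s ⊆ Finset.Ico a (a + M)) :
    |∑ q ∈ s, boxPiece n α u v l q|
      ≤ 6 ^ d * closeCount (fun i => (α i : UnitAddCircle)) M l := by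
  rw [← Finset.sum_filter_ne_zero]
  refine (Finset.abs_sum_le_sum_abs _ _).trans ?_
  refine (Finset.sum_le_card_nsmul _ _ (3 ^ d) fun q _ => abs_boxPiece_le α hb l q).trans ?_
  rw [nsmul_eq_mul]
  have h : (((s.filter fun q => boxPiece n α u v l q ≠ 0).card : ℕ) : ℝ)
      ≤ 2 ^ d * closeCount (fun i => (α i : UnitAddCircle)) M l := by
    exact_mod_cast card_filter_boxPiece_le α u v l hl a M s hs
  calc _ ≤ (2 ^ d * closeCount (fun i => (α i : UnitAddCircle)) M l : ℝ) * 3 ^ d := by gcongr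
    _ = _ := by rw [show (6 : ℝ) = 2 * 3 by norm_num, mul_pow]; ring

/-- Comparison of a sum with its translates. -/
theorem abs_sum_boxPiece_shift_le {d n : ℕ} (α : Fin d → ℝ) {u v : Fin d → ℝ}
    (hb : ∀ i, 0 ≤ u i ∧ u i ≤ v i ∧ v i ≤ 1) (l : Fin d → ℕ)
    (hl : ∀ i, l i ≤ n) (N K t : ℕ) (ht : t ≤ K) :
    |∑ q ∈ Finset.range N, boxPiece n α u v l q - ∑ q ∈ Finset.range N, boxPiece n α u v l (q + t)|
      ≤ 2 * 6 ^ d * closeCount (fun i => (α i : UnitAddCircle)) K l := by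
  have e1 : ∑ q ∈ Finset.range N, boxPiece n α u v l q
      - ∑ q ∈ Finset.range N, boxPiece n α u v l (q + t)
      = ∑ q ∈ Finset.Ico 0 t, boxPiece n α u v l q
        - ∑ q ∈ Finset.Ico N (N + t), boxPiece n α u v l q := by
    have h1 := Finset.sum_range_add (boxPiece n α u v l) t N
    have h2 := Finset.sum_range_add (boxPiece n α u v l) N t
    rw [add_comm t N] at h1
    rw [Finset.sum_Ico_eq_sum_range, Finset.sum_Ico_eq_sum_range]
    simp only [Nat.sub_zero, zero_add, Nat.add_sub_cancel_left]
    have h3 : ∑ q ∈ Finset.range N, boxPiece n α u v l (q + t)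
        = ∑ q ∈ Finset.range N, boxPiece n α u v l (t + q) := by simp only [add_comm]
    rw [h3]
    linarith
  rw [e1]
  refine (abs_sub _ _).trans ?_
  have h1 := abs_sum_boxPiece_le α hb l hl 0 K (Finset.Ico 0 t)
    (Finset.Ico_subset_Ico_right (by omega))
  have h2 := abs_sum_boxPiece_le α hb l hl N K (Finset.Ico N (N + t))
    (Finset.Ico_subset_Ico_right (by omega))
  linarith

theorem abs_sum_sub_average_le {d n : ℕ} (α : Fin d → ℝ) {u v : Fin d → ℝ}
    (hb : ∀ i, 0 ≤ u i ∧ u i ≤ v i ∧ v i ≤ 1) (l : Fin d → ℕ)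
    (hl : ∀ i, l i ≤ n) (N K : ℕ) (hK : 0 < K) :
    |∑ q ∈ Finset.range N, boxPiece n α u v l q
        - (∑ t ∈ Finset.range K, ∑ q ∈ Finset.range N, boxPiece n α u v l (q + t)) / K|
      ≤ 2 * 6 ^ d * closeCount (fun i => (α i : UnitAddCircle)) K l := by
  have hK' : (0 : ℝ) < K := by exact_mod_cast hK
  have e : ∑ q ∈ Finset.range N, boxPiece n α u v l q
        - (∑ t ∈ Finset.range K, ∑ q ∈ Finset.range N, boxPiece n α u v l (q + t)) / K
      = (∑ t ∈ Finset.range K, (∑ q ∈ Finset.range N, boxPiece n α u v l q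
        - ∑ q ∈ Finset.range N, boxPiece n α u v l (q + t))) / K := by
    rw [Finset.sum_sub_distrib, Finset.sum_const, Finset.card_range, nsmul_eq_mul]
    field_simp
  rw [e, abs_div, abs_of_pos hK', div_le_iff₀ hK']
  refine (Finset.abs_sum_le_sum_abs _ _).trans ?_
  refine (Finset.sum_le_card_nsmul _ _ _ fun t ht =>
    abs_sum_boxPiece_shift_le α hb l hl N K t (Finset.mem_range.1 ht).le).trans ?_
  rw [Finset.card_range, nsmul_eq_mul, mul_comm]

theorem norm_prod_sub_prod_le {ι : Type*} (s : Finset ι) (a b : ι → ℂ) {η : ℝ} (hη : 0 ≤ η)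
    (ha : ∀ i ∈ s, ‖a i‖ ≤ 4) (hb : ∀ i ∈ s, ‖b i‖ ≤ 4) (hab : ∀ i ∈ s, ‖a i - b i‖ ≤ η) :
    ‖∏ i ∈ s, a i - ∏ i ∈ s, b i‖ ≤ s.card * 4 ^ s.card * η := by
  classical
  induction s using Finset.induction_on with
  | empty => simp
  | insert j s hj ih =>
    have ih' := ih (fun i hi => ha i (Finset.mem_insert_of_mem hi))
      (fun i hi => hb i (Finset.mem_insert_of_mem hi))
      (fun i hi => hab i (Finset.mem_insert_of_mem hi))
    rw [Finset.prod_insert hj, Finset.prod_insert hj, Finset.card_insert_of_notMem hj]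
    have e : a j * ∏ i ∈ s, a i - b j * ∏ i ∈ s, b i
        = (a j - b j) * ∏ i ∈ s, a i + b j * (∏ i ∈ s, a i - ∏ i ∈ s, b i) := by ring
    have hP : ‖∏ i ∈ s, a i‖ ≤ 4 ^ s.card := by
      rw [norm_prod]
      rw [← Finset.prod_const]
      exact Finset.prod_le_prod (fun i _ => norm_nonneg _)
        fun i hi => ha i (Finset.mem_insert_of_mem hi)
    rw [e]
    refine (norm_add_le _ _).trans ?_
    rw [norm_mul, norm_mul]
    have h1 := hab j (Finset.mem_insert_self _ _)
    have h2 := hb j (Finset.mem_insert_self _ _)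
    calc _ ≤ η * 4 ^ s.card + 4 * (s.card * 4 ^ s.card * η) := by gcongr
      _ ≤ _ := by
        push_cast
        rw [pow_succ]
        nlinarith [mul_nonneg hη (show (0 : ℝ) ≤ 4 ^ s.card by positivity)]

/-- The linear form `h ↦ ∑ i, h i • x i` on the torus. -/
noncomputable def lin {d : ℕ} (h : Fin d → ℤ) (x : Fin d → UnitAddCircle) : UnitAddCircle := ∑ i, h i • x i

/-- The integer vectors with all coordinates in `[-H, H]`. -/
noncomputable def box (d H : ℕ) : Finset (Fin d → ℤ) := Fintype.piFinset fun _ => Finset.Icc (-(H : ℤ)) H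

theorem mem_box {d H : ℕ} {h : Fin d → ℤ} : h ∈ box d H ↔ ∀ i, |h i| ≤ H := by
  simp [box, Fintype.mem_piFinset, abs_le]

theorem zero_mem_box (d H : ℕ) : (0 : Fin d → ℤ) ∈ box d H := by
  rw [mem_box]; simp

theorem prod_fourier_nsmul {d : ℕ} (h : Fin d → ℤ) (x : Fin d → UnitAddCircle) (q : ℕ) :
    ∏ i, (fourier (h i) (q • x i) : ℂ) = (fourier 1 (lin h x) : ℂ) ^ q := by
  have h1 : ∀ (s : Finset (Fin d)) (y : Fin d → UnitAddCircle),
      (AddCircle.toCircle (∑ i ∈ s, y i) : ℂ) = ∏ i ∈ s, (AddCircle.toCircle (y i) : ℂ) := by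
    intro s y
    induction s using Finset.induction_on with
    | empty => simp
    | insert j s hj ih =>
      rw [Finset.sum_insert hj, Finset.prod_insert hj, AddCircle.toCircle_add, Circle.coe_mul, ih]
  simp only [fourier_apply, one_smul, lin]
  rw [h1, ← Finset.prod_pow]
  refine Finset.prod_congr rfl fun i _ => ?_
  rw [smul_comm, AddCircle.toCircle_nsmul, Circle.coe_pow]

theorem four_mul_norm_le (θ : UnitAddCircle) : 4 * ‖θ‖ ≤ ‖(fourier 1 θ : ℂ) - 1‖ := by
  induction θ using QuotientAddGroup.induction_on with
  | H y =>
    have hr : ((y - round y : ℝ) : UnitAddCircle) = (y : UnitAddCircle) := by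
      rw [AddCircle.coe_sub, coe_intCast_eq_zero, sub_zero]
    change 4 * ‖(y : UnitAddCircle)‖ ≤ ‖(fourier 1 (y : UnitAddCircle) : ℂ) - 1‖
    rw [UnitAddCircle.norm_eq, ← hr]
    have h2 := abs_sub_round y
    set t := y - round y
    have e : (fourier 1 (t : UnitAddCircle) : ℂ) = Complex.exp (Complex.I * ((2 * π * t : ℝ))) := by
      rw [fourier_coe_apply]
      congr 1; push_cast; ring
    rw [e, Complex.norm_exp_I_mul_ofReal_sub_one, show 2 * π * t / 2 = π * t by ring, norm_mul,
      Real.norm_eq_abs, Real.norm_eq_abs, abs_of_pos (zero_lt_two' ℝ)]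
    have h3 : 2 / π * (π * |t|) ≤ sin (π * |t|) :=
      Real.mul_le_sin (by positivity) (by nlinarith [pi_pos])
    have h4 : |sin (π * t)| = sin (π * |t|) := by
      rcases abs_cases t with ⟨h, h'⟩ | ⟨h, h'⟩
      · rw [h] at h3 ⊢
        exact abs_of_nonneg ((by positivity : 0 ≤ 2 / π * (π * t)).trans h3)
      · rw [h] at h3 ⊢
        rw [mul_neg, sin_neg] at *
        refine abs_of_nonpos ?_
        have : 0 ≤ 2 / π * (-(π * t)) := mul_nonneg (by positivity) (by nlinarith [pi_pos])
        linarith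
    have h5 : 2 / π * (π * |t|) = 2 * |t| := by field_simp
    rw [h4]
    linarith

theorem norm_geom_le (θ : UnitAddCircle) (K : ℕ) :
    ‖∑ t ∈ Finset.range K, (fourier 1 θ : ℂ) ^ t‖ ≤ K := by
  refine (norm_sum_le _ _).trans ?_
  simp only [norm_pow, norm_fourier_apply, one_pow]
  simp

theorem norm_geom_le' {θ : UnitAddCircle} (hθ : θ ≠ 0) (K : ℕ) :
    ‖∑ t ∈ Finset.range K, (fourier 1 θ : ℂ) ^ t‖ ≤ 1 / ‖θ‖ := by
  have h0 : 0 < ‖θ‖ := norm_pos_iff.2 hθ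
  have h4 := four_mul_norm_le θ
  have hz : (fourier 1 θ : ℂ) ≠ 1 := by
    intro h
    rw [h, sub_self, norm_zero] at h4
    linarith
  rw [geom_sum_eq hz, norm_div]
  have h2 : ‖(fourier 1 θ : ℂ) ^ K - 1‖ ≤ 2 := by
    refine (norm_sub_le _ _).trans ?_
    rw [norm_pow, norm_fourier_apply]; norm_num
  calc _ ≤ 2 / (4 * ‖θ‖) := by gcongr
    _ ≤ _ := by rw [div_le_div_iff₀ (by positivity) h0]; linarith

theorem sum_trig_eq {d : ℕ} (x : Fin d → UnitAddCircle) (c : Fin d → ℤ → ℂ) (H N K : ℕ) :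
    ∑ t ∈ Finset.range K, ∑ q ∈ Finset.range N,
        ∏ i, ∑ k ∈ Finset.Icc (-(H : ℤ)) H, c i k * fourier k ((q + t) • x i)
      = ∑ h ∈ box d H, (∏ i, c i (h i)) * ((∑ t ∈ Finset.range K, (fourier 1 (lin h x) : ℂ) ^ t) *
          ∑ q ∈ Finset.range N, (fourier 1 (lin h x) : ℂ) ^ q) := by
  have e : ∀ t q : ℕ, ∏ i, ∑ k ∈ Finset.Icc (-(H : ℤ)) H, c i k * fourier k ((q + t) • x i)
      = ∑ h ∈ box d H, (∏ i, c i (h i)) * ((fourier 1 (lin h x) : ℂ) ^ t *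
          (fourier 1 (lin h x) : ℂ) ^ q) := by
    intro t q
    rw [Finset.prod_univ_sum]
    refine Finset.sum_congr rfl fun h _ => ?_
    rw [Finset.prod_mul_distrib, prod_fourier_nsmul, pow_add, mul_comm (_ ^ q)]
  simp only [e]
  rw [Finset.sum_congr rfl fun t _ => Finset.sum_comm, Finset.sum_comm]
  refine Finset.sum_congr rfl fun h _ => ?_
  rw [Finset.sum_mul_sum, Finset.mul_sum]
  simp only [Finset.mul_sum]

theorem norm_average_trig_sub_le {d : ℕ} (x : Fin d → UnitAddCircle) (c : Fin d → ℤ → ℂ)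
    (H N K : ℕ) (hK : 0 < K) (hx : ∀ h ∈ box d H, h ≠ 0 → lin h x ≠ 0) :
    ‖(∑ t ∈ Finset.range K, ∑ q ∈ Finset.range N,
        ∏ i, ∑ k ∈ Finset.Icc (-(H : ℤ)) H, c i k * fourier k ((q + t) • x i)) / K
        - N * ∏ i, c i 0‖
      ≤ ∑ h ∈ (box d H).erase 0, (∏ i, ‖c i (h i)‖) *
          (min 1 (1 / (K * ‖lin h x‖)) / ‖lin h x‖) := by
  have hK' : (0 : ℝ) < K := by exact_mod_cast hK
  have hK'' : (K : ℂ) ≠ 0 := by exact_mod_cast hK.ne'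
  rw [sum_trig_eq, ← Finset.add_sum_erase _ _ (zero_mem_box d H), add_div]
  have e0 : lin (0 : Fin d → ℤ) x = 0 := by simp [lin]
  have e1 : (∏ i, c i ((0 : Fin d → ℤ) i)) * ((∑ t ∈ Finset.range K, (fourier 1 (lin 0 x) : ℂ) ^ t)
      * ∑ q ∈ Finset.range N, (fourier 1 (lin 0 x) : ℂ) ^ q) / K = N * ∏ i, c i 0 := by
    rw [e0]
    simp
    field_simp
  rw [e1, add_sub_cancel_left, norm_div, Complex.norm_natCast, div_le_iff₀ hK', Finset.sum_mul]
  refine norm_sum_le_of_le _ fun h hh => ?_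
  obtain ⟨hne, hmem⟩ := Finset.mem_erase.1 hh
  have hθ := hx h hmem hne
  have hw : 0 < ‖lin h x‖ := norm_pos_iff.2 hθ
  rw [norm_mul, norm_prod, norm_mul, mul_assoc]
  refine mul_le_mul_of_nonneg_left ?_ (Finset.prod_nonneg fun i _ => norm_nonneg _)
  have h1 : ‖∑ t ∈ Finset.range K, (fourier 1 (lin h x) : ℂ) ^ t‖
      ≤ min 1 (1 / (K * ‖lin h x‖)) * K := by
    rw [min_mul_of_nonneg _ _ hK'.le]
    refine le_min (by rw [one_mul]; exact norm_geom_le _ _) ?_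
    refine (norm_geom_le' hθ K).trans_eq ?_
    field_simp
  calc _ ≤ (min 1 (1 / (K * ‖lin h x‖)) * K) * (1 / ‖lin h x‖) := by
        gcongr
        exact norm_geom_le' hθ N
    _ = _ := by ring

/-- `max 1 |k|`. -/
noncomputable def rad (k : ℤ) : ℝ := max 1 |(k : ℝ)|

theorem one_le_rad (k : ℤ) : 1 ≤ rad k := le_max_left _ _

theorem rad_pos (k : ℤ) : 0 < rad k := zero_lt_one.trans_le (one_le_rad k)

theorem rad_of_ne {k : ℤ} (hk : k ≠ 0) : rad k = |(k : ℝ)| := by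
  refine max_eq_right ?_
  exact_mod_cast Int.one_le_abs hk

/-- Bound for the size of `pieceCoeff`. -/
noncomputable def coeffBound (l : ℕ) (k : ℤ) : ℝ :=
  if k = 0 then (if l = 0 then 1 else 0) else min ((1 / 2) ^ l) (2 ^ l / k ^ 2)

theorem norm_pieceCoeff_le_coeffBound {u v : ℝ} (hu : 0 ≤ u) (huv : u ≤ v) (hv : v ≤ 1) (l : ℕ)
    (k : ℤ) : ‖pieceCoeff u v l k‖ ≤ coeffBound l k := by
  unfold coeffBound
  split_ifs with hk hl
  · rw [hk, hl]; simpa using norm_pieceCoeff_le hu huv hv 0 0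
  · rw [hk, pieceCoeff_zero, if_neg hl, norm_zero]
  · exact le_min (norm_pieceCoeff_le hu huv hv l k) (norm_pieceCoeff_le' u v l hk)

theorem coeffBound_nonneg (l : ℕ) (k : ℤ) : 0 ≤ coeffBound l k := by
  unfold coeffBound
  split_ifs <;> positivity

theorem sum_pow_three_quarters_le (s : Finset ℕ) : ∑ j ∈ s, (3 / 4 : ℝ) ^ j ≤ 4 := by
  have h := summable_geometric_of_lt_one (r := (3 / 4 : ℝ)) (by norm_num) (by norm_num)
  refine (h.sum_le_tsum s fun i _ => by positivity).trans ?_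
  rw [tsum_geometric_of_lt_one (by norm_num) (by norm_num)]
  norm_num

theorem sum_coeffBound_mul_pow_le {k : ℤ} (hk : k ≠ 0) (n : ℕ) {b : ℝ} (hb : 2 / 3 ≤ b)
    (hb1 : b ≤ 1) :
    ∑ l ∈ Finset.range n, coeffBound l k * b ^ l ≤ 12 * b ^ (Nat.log 2 k.natAbs) / |(k : ℝ)| := by
  set m := Nat.log 2 k.natAbs with hm
  have hk0 : k.natAbs ≠ 0 := by simpa using hk
  have hka : |(k : ℝ)| = (k.natAbs : ℝ) := by rw [Nat.cast_natAbs]; simp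
  have hlo : (2 : ℝ) ^ m ≤ |(k : ℝ)| := by
    rw [hka]; exact_mod_cast Nat.pow_log_le_self 2 hk0
  have hhi : |(k : ℝ)| < 2 * 2 ^ m := by
    rw [hka]
    have := Nat.lt_pow_succ_log_self (b := 2) (by norm_num) k.natAbs
    rw [pow_succ, mul_comm] at this
    exact_mod_cast this
  have hkp : 0 < |(k : ℝ)| := lt_of_lt_of_le (by positivity) hlo
  have hbp : 0 < b := by linarith
  set X := b ^ m / |(k : ℝ)| with hX
  have hXp : 0 < X := by positivity
  have hterm : ∀ l, coeffBound l k * b ^ l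
      ≤ if l ≤ m then X * (3 / 4) ^ (m - l) else 2 * X * (3 / 4) ^ (l - m) := by
    intro l
    rw [coeffBound, if_neg hk]
    split_ifs with hl
    · calc _ ≤ 2 ^ l / (k : ℝ) ^ 2 * b ^ l := by gcongr; exact min_le_right _ _
        _ = (2 * b) ^ l / |(k : ℝ)| ^ 2 := by rw [sq_abs, mul_pow]; ring
        _ ≤ (2 * b) ^ m * (3 / 4) ^ (m - l) / |(k : ℝ)| ^ 2 := by
            gcongr
            obtain ⟨p, hp⟩ := Nat.exists_eq_add_of_le hl
            rw [hp, Nat.add_sub_cancel_left, pow_add, mul_assoc, ← mul_pow]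
            exact le_mul_of_one_le_right (by positivity) (one_le_pow₀ (by linarith))
        _ = 2 ^ m * (b ^ m * (3 / 4) ^ (m - l)) / |(k : ℝ)| ^ 2 := by rw [mul_pow]; ring
        _ ≤ |(k : ℝ)| * (b ^ m * (3 / 4) ^ (m - l)) / |(k : ℝ)| ^ 2 := by gcongr
        _ = _ := by rw [hX]; field_simp
    · push Not at hl
      obtain ⟨p, rfl⟩ := Nat.exists_eq_add_of_le hl.le
      rw [Nat.add_sub_cancel_left]
      calc _ ≤ (1 / 2 : ℝ) ^ (m + p) * b ^ (m + p) := by gcongr; exact min_le_left _ _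
        _ = (1 / 2) ^ m * b ^ m * (1 / 2 * b) ^ p := by rw [mul_pow]; ring
        _ ≤ (2 / |(k : ℝ)|) * b ^ m * (3 / 4) ^ p := by
            gcongr
            · rw [one_div_pow, div_le_div_iff₀ (by positivity) hkp]; linarith
            · linarith
        _ = _ := by rw [hX]; ring
  calc _ ≤ ∑ l ∈ Finset.range n, (if l ≤ m then X * (3 / 4) ^ (m - l)
        else 2 * X * (3 / 4) ^ (l - m)) := Finset.sum_le_sum fun l _ => hterm l
    _ ≤ X * 4 + 2 * X * 4 := by
        rw [Finset.sum_ite, ← Finset.mul_sum, ← Finset.mul_sum]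
        gcongr
        · rw [← Finset.sum_image (g := fun l => m - l) (f := fun j => (3 / 4 : ℝ) ^ j)]
          · exact sum_pow_three_quarters_le _
          · intro a ha c hc h
            simp at ha hc h
            omega
        · rw [← Finset.sum_image (g := fun l => l - m) (f := fun j => (3 / 4 : ℝ) ^ j)]
          · exact sum_pow_three_quarters_le _
          · intro a ha c hc h
            simp at ha hc h
            omega
    _ = _ := by rw [hX]; ring

/-- `∏ i, max 1 |h i|`. -/
noncomputable def height {d : ℕ} (h : Fin d → ℤ) : ℝ := ∏ i, rad (h i)

theorem one_le_height {d : ℕ} (h : Fin d → ℤ) : 1 ≤ height h :=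
  Finset.prod_induction _ (fun y => 1 ≤ y) (fun _ _ => one_le_mul_of_one_le_of_one_le) le_rfl
    fun i _ => one_le_rad (h i)

theorem height_pos {d : ℕ} (h : Fin d → ℤ) : 0 < height h := zero_lt_one.trans_le (one_le_height h)

/-- The minimum of `u ^ (-1)` and `u ^ (-3 / 2)`. -/
noncomputable def decay (u : ℝ) : ℝ := min (1 / u) (1 / (u * √u))

theorem sum_coeffBound_le (k : ℤ) (n : ℕ) :
    ∑ l ∈ Finset.range n, coeffBound l k ≤ 17 / rad k := by
  by_cases hk : k = 0
  · subst hk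
    have : ∑ l ∈ Finset.range n, coeffBound l 0 ≤ 1 := by
      simp only [coeffBound, if_true, Finset.sum_ite_eq']
      split_ifs <;> norm_num
    refine this.trans ?_
    simp [rad]
  · have h := sum_coeffBound_mul_pow_le hk n (b := 1) (by norm_num) le_rfl
    simp only [one_pow, mul_one] at h
    rw [rad_of_ne hk]
    refine h.trans ?_
    gcongr
    norm_num

theorem sum_coeffBound_mul_sqrt_le (k : ℤ) (n : ℕ) :
    ∑ l ∈ Finset.range n, coeffBound l k * √(1 / 2) ^ l ≤ 17 / (rad k * √(rad k)) := by
  by_cases hk : k = 0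
  · subst hk
    have : ∑ l ∈ Finset.range n, coeffBound l 0 * √(1 / 2) ^ l ≤ 1 := by
      simp only [coeffBound, if_true, ite_mul, zero_mul, Finset.sum_ite_eq']
      split_ifs <;> norm_num
    refine this.trans ?_
    simp [rad]
  · have hb : 2 / 3 ≤ √(1 / 2 : ℝ) := Real.le_sqrt_of_sq_le (by norm_num)
    have hb1 : √(1 / 2 : ℝ) ≤ 1 := Real.sqrt_le_one.2 (by norm_num)
    have h := sum_coeffBound_mul_pow_le hk n hb hb1
    rw [rad_of_ne hk]
    refine h.trans ?_
    set m := Nat.log 2 k.natAbs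
    have hka : |(k : ℝ)| = (k.natAbs : ℝ) := by rw [Nat.cast_natAbs]; simp
    have hhi : |(k : ℝ)| < 2 * 2 ^ m := by
      rw [hka]
      have := Nat.lt_pow_succ_log_self (b := 2) (by norm_num) k.natAbs
      rw [pow_succ, mul_comm] at this
      exact_mod_cast this
    have hkp : 0 < |(k : ℝ)| := by positivity
    have hs : 12 * √(1 / 2 : ℝ) ^ m ≤ 17 / √|(k : ℝ)| := by
      rw [le_div_iff₀ (by positivity)]
      refine abs_le_of_sq_le_sq' ?_ (by norm_num) |>.2
      rw [mul_pow, mul_pow, Real.sq_sqrt hkp.le, ← pow_mul, mul_comm m 2, pow_mul,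
        Real.sq_sqrt (by norm_num)]
      have : (1 / 2 : ℝ) ^ m * |(k : ℝ)| ≤ 2 := by
        rw [one_div_pow, one_div, inv_mul_le_iff₀ (by positivity)]; linarith
      nlinarith
    calc _ ≤ (17 / √|(k : ℝ)|) / |(k : ℝ)| := by gcongr
      _ = _ := by rw [div_div, mul_comm]

theorem sum_scales_le {d : ℕ} (n : ℕ) (h : Fin d → ℤ) {w : ℝ} (hw : 0 < w) :
    ∑ l ∈ Fintype.piFinset fun _ : Fin d => Finset.range n,
        (∏ i, coeffBound (l i) (h i)) * (min 1 (1 / (((2 ^ ∑ i, l i : ℕ) : ℝ) * w)) / w)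
      ≤ 17 ^ d * decay (height h * w) := by
  have hr := height_pos h
  have h1 : ∀ y : ℝ, 0 ≤ y → min 1 y ≤ √y := by
    intro y hy
    rcases le_total 1 y with h | h
    · exact (min_le_left _ _).trans (Real.one_le_sqrt.2 h)
    · exact (min_le_right _ _).trans (Real.le_sqrt_of_sq_le (by nlinarith))
  have hprod : ∏ i, √(rad (h i)) = √(height h) := by
    rw [height, Real.sqrt_prod _ fun i _ => (rad_pos _).le]
  have key : ∀ f : ℕ → ℤ → ℝ, ∑ l ∈ Fintype.piFinset fun _ : Fin d => Finset.range n,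
      ∏ i, f (l i) (h i) = ∏ i, ∑ l ∈ Finset.range n, f l (h i) := fun f => by
    rw [Finset.prod_univ_sum]
  rw [decay, mul_min_of_nonneg _ _ (by positivity)]
  refine le_min ?_ ?_
  · calc _ ≤ ∑ l ∈ Fintype.piFinset fun _ : Fin d => Finset.range n,
          (∏ i, coeffBound (l i) (h i)) * (1 / w) := by
          gcongr with l hl
          · exact Finset.prod_nonneg fun i _ => coeffBound_nonneg _ _
          · exact min_le_left _ _
      _ = (∏ i, ∑ l ∈ Finset.range n, coeffBound l (h i)) * (1 / w) := by
          rw [← Finset.sum_mul, key]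
      _ ≤ (∏ i, 17 / rad (h i)) * (1 / w) := by
          gcongr with i
          · intro i _
            exact Finset.sum_nonneg fun l _ => coeffBound_nonneg _ _
          · exact sum_coeffBound_le _ _
      _ = _ := by
          rw [Finset.prod_div_distrib, ← height]
          simp
          ring
  · calc _ ≤ ∑ l ∈ Fintype.piFinset fun _ : Fin d => Finset.range n,
          (∏ i, (coeffBound (l i) (h i) * √(1 / 2) ^ l i)) * (1 / (w * √w)) := by
          refine Finset.sum_le_sum fun l _ => ?_
          rw [Finset.prod_mul_distrib, Finset.prod_pow_eq_pow_sum, mul_assoc]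
          refine mul_le_mul_of_nonneg_left ?_ (Finset.prod_nonneg fun i _ => coeffBound_nonneg _ _)
          calc _ ≤ √(1 / (((2 ^ ∑ i, l i : ℕ) : ℝ) * w)) / w := by
                gcongr
                exact h1 _ (by positivity)
            _ = _ := by
                rw [Nat.cast_pow, ← div_div, ← one_div_pow, Real.sqrt_div (by positivity)]
                have : √((1 / ((2 : ℕ) : ℝ)) ^ ∑ i, l i) = √(1 / 2) ^ ∑ i, l i := by
                  rw [Real.sqrt_eq_iff_mul_self_eq (by positivity) (by positivity), ← mul_pow,
                    Real.mul_self_sqrt (by norm_num)]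
                  norm_num
                rw [this]
                have := Real.sqrt_pos.2 hw
                field_simp
      _ = (∏ i, ∑ l ∈ Finset.range n, coeffBound l (h i) * √(1 / 2) ^ l) * (1 / (w * √w)) := by
          rw [← Finset.sum_mul, key fun l k => coeffBound l k * √(1 / 2) ^ l]
      _ ≤ (∏ i, 17 / (rad (h i) * √(rad (h i)))) * (1 / (w * √w)) := by
          gcongr with i
          · intro i _
            exact Finset.sum_nonneg fun l _ => mul_nonneg (coeffBound_nonneg _ _) (by positivity)
          · exact sum_coeffBound_mul_sqrt_le _ _
      _ = _ := by
          rw [Finset.prod_div_distrib, Finset.prod_mul_distrib, hprod, ← height,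
            Real.sqrt_mul hr.le]
          simp
          ring

/-- The contribution of the dyadic piece `l` to the volume of a box. -/
noncomputable def pieceMean {d : ℕ} (u v : Fin d → ℝ) (l : Fin d → ℕ) : ℝ :=
  ∏ i, if l i = 0 then v i - u i else 0

theorem norm_boxPiece_sub_le {d n : ℕ} (hn : 1 ≤ n) (α : Fin d → ℝ) {u v : Fin d → ℝ}
    (hb : ∀ i, 0 ≤ u i ∧ u i ≤ v i ∧ v i ≤ 1) (l : Fin d → ℕ) (hl : ∀ i, l i < n) (q : ℕ) :
    ‖((boxPiece n α u v l q : ℝ) : ℂ) - ∏ i, ∑ k ∈ Finset.Icc (-((4 ^ n : ℕ) : ℤ)) (4 ^ n : ℕ),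
        pieceCoeff (u i) (v i) (l i) k * fourier k (q • (α i : UnitAddCircle))‖
      ≤ d * 4 ^ d * (2 / 2 ^ n) := by
  have e : ∀ i, q • (α i : UnitAddCircle) = ((q * α i : ℝ) : UnitAddCircle) := by
    intro i
    rw [← AddCircle.coe_nsmul]
    simp
  have hη : (2 : ℝ) / 2 ^ n ≤ 1 := by
    rw [div_le_one (by positivity)]
    exact le_self_pow₀ (by norm_num) (by omega)
  have h1 : ∀ i, ‖((piece n (u i) (v i) (l i) (q * α i) : ℝ) : ℂ)
      - ∑ k ∈ Finset.Icc (-((4 ^ n : ℕ) : ℤ)) (4 ^ n : ℕ),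
        pieceCoeff (u i) (v i) (l i) k * fourier k (q • (α i : UnitAddCircle))‖ ≤ 2 / 2 ^ n := by
    intro i
    rw [e]
    refine (abs_piece_sub_sum_le (hl i) (u i) (v i) (q * α i) (H := 4 ^ n) (by positivity)).trans ?_
    have : (2 : ℝ) ^ l i ≤ 2 ^ n := pow_le_pow_right₀ (by norm_num) (hl i).le
    calc _ ≤ (2 : ℝ) ^ n * (2 / ((4 ^ n : ℕ) : ℝ)) := by gcongr
      _ = _ := by
        rw [show 4 = 2 * 2 by norm_num, mul_pow]
        push_cast
        field_simp
  have h2 : ∀ i, ‖((piece n (u i) (v i) (l i) (q * α i) : ℝ) : ℂ)‖ ≤ 3 := by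
    intro i
    rw [Complex.norm_real]
    exact abs_piece_le n (l i) (hb i).1 (hb i).2.1 (hb i).2.2 _
  rw [boxPiece, Complex.ofReal_prod]
  refine (norm_prod_sub_prod_le Finset.univ _ _ (η := 2 / 2 ^ n) (by positivity)
    (fun i _ => (h2 i).trans (by norm_num)) (fun i _ => ?_) (fun i _ => h1 i)).trans ?_
  · have := norm_le_norm_add_norm_sub' (∑ k ∈ Finset.Icc (-((4 ^ n : ℕ) : ℤ)) (4 ^ n : ℕ),
        pieceCoeff (u i) (v i) (l i) k * fourier k (q • (α i : UnitAddCircle)))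
        ((piece n (u i) (v i) (l i) (q * α i) : ℝ) : ℂ)
    rw [norm_sub_rev] at this
    linarith [h1 i, h2 i]
  · simp

theorem abs_sum_boxPiece_sub_mean_le {d n : ℕ} (hn : 1 ≤ n) (α : Fin d → ℝ) {u v : Fin d → ℝ}
    (hb : ∀ i, 0 ≤ u i ∧ u i ≤ v i ∧ v i ≤ 1) (l : Fin d → ℕ) (hl : ∀ i, l i < n)
    (N : ℕ) (hN : N ≤ 2 ^ n)
    (hx : ∀ h ∈ box d (4 ^ n), h ≠ 0 → lin h (fun i => (α i : UnitAddCircle)) ≠ 0) :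
    |∑ q ∈ Finset.range N, boxPiece n α u v l q - N * pieceMean u v l|
      ≤ (2 * 6 ^ d + 2 * d * 4 ^ d) *
          closeCount (fun i => (α i : UnitAddCircle)) (2 ^ ∑ i, l i) l +
        ∑ h ∈ (box d (4 ^ n)).erase 0, (∏ i, coeffBound (l i) (h i)) *
          (min 1 (1 / (((2 ^ ∑ i, l i : ℕ) : ℝ) * ‖lin h (fun i => (α i : UnitAddCircle))‖))
            / ‖lin h (fun i => (α i : UnitAddCircle))‖) := by
  set x : Fin d → UnitAddCircle := fun i => (α i : UnitAddCircle) with hxdef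
  set K := 2 ^ ∑ i, l i with hKdef
  have hK : 0 < K := by positivity
  have hK' : (0 : ℝ) < K := by exact_mod_cast hK
  set P : ℕ → ℂ := fun q => ∏ i, ∑ k ∈ Finset.Icc (-((4 ^ n : ℕ) : ℤ)) (4 ^ n : ℕ),
        pieceCoeff (u i) (v i) (l i) k * fourier k (q • x i) with hP
  have hmean : ((pieceMean u v l : ℝ) : ℂ) = ∏ i, pieceCoeff (u i) (v i) (l i) 0 := by
    rw [pieceMean, Complex.ofReal_prod]
    refine Finset.prod_congr rfl fun i _ => ?_
    rw [pieceCoeff_zero]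
    split_ifs <;> simp
  have h1 := abs_sum_sub_average_le α hb l (fun i => (hl i).le) N K hK
  have h2 : ‖(∑ t ∈ Finset.range K, ∑ q ∈ Finset.range N, ((boxPiece n α u v l (q + t) : ℝ) : ℂ)) / K
      - (∑ t ∈ Finset.range K, ∑ q ∈ Finset.range N, P (q + t)) / K‖ ≤ 2 * d * 4 ^ d := by
    rw [← sub_div, norm_div, Complex.norm_natCast, div_le_iff₀ hK', ← Finset.sum_sub_distrib]
    simp only [← Finset.sum_sub_distrib]
    calc _ ≤ ∑ t ∈ Finset.range K, ∑ q ∈ Finset.range N, (d * 4 ^ d * (2 / 2 ^ n) : ℝ) :=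
          norm_sum_le_of_le _ fun t _ => norm_sum_le_of_le _ fun q _ =>
            norm_boxPiece_sub_le hn α hb l hl (q + t)
      _ = K * (d * 4 ^ d * 2) * (N / 2 ^ n) := by simp; ring
      _ ≤ K * (d * 4 ^ d * 2) * 1 := by
          gcongr
          rw [div_le_one (by positivity)]
          exact_mod_cast hN
      _ = _ := by ring
  have h3 := norm_average_trig_sub_le x (fun i k => pieceCoeff (u i) (v i) (l i) k) (4 ^ n) N K hK hx
  have h3' := h3.trans (Finset.sum_le_sum fun h _ => mul_le_mul_of_nonneg_right
    (Finset.prod_le_prod (fun i _ => norm_nonneg _) fun i _ =>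
      norm_pieceCoeff_le_coeffBound (hb i).1 (hb i).2.1 (hb i).2.2 (l i) (h i))
    (by positivity))
  have h4 := one_le_closeCount x hK l
  have h4' : (1 : ℝ) ≤ closeCount x K l := by exact_mod_cast h4
  have h5 : |(∑ t ∈ Finset.range K, ∑ q ∈ Finset.range N, boxPiece n α u v l (q + t)) / K
      - N * pieceMean u v l| ≤ 2 * d * 4 ^ d +
        ∑ h ∈ (box d (4 ^ n)).erase 0, (∏ i, coeffBound (l i) (h i)) *
          (min 1 (1 / ((K : ℝ) * ‖lin h x‖)) / ‖lin h x‖) := by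
    rw [← Real.norm_eq_abs, ← Complex.norm_real]
    push_cast
    rw [hmean]
    refine (norm_sub_le_norm_sub_add_norm_sub _ _ _).trans (add_le_add h2 h3')
  have h6 := abs_sub_le (∑ q ∈ Finset.range N, boxPiece n α u v l q)
    ((∑ t ∈ Finset.range K, ∑ q ∈ Finset.range N, boxPiece n α u v l (q + t)) / K)
    (N * pieceMean u v l)
  have h7 : (2 * d * 4 ^ d : ℝ) ≤ 2 * d * 4 ^ d * closeCount x K l :=
    le_mul_of_one_le_right (by positivity) h4'
  linarith

theorem card_eq_sum_boxPiece {d : ℕ} (n : ℕ) (α : Fin d → ℝ) {u v : Fin d → ℝ}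
    (hb : ∀ i, 0 ≤ u i ∧ u i ≤ v i ∧ v i ≤ 1) (N : ℕ) :
    (Nat.card {q : ℕ // q < N ∧ ∀ i, u i ≤ Int.fract (q * α i) ∧ Int.fract (q * α i) < v i} : ℝ)
      = ∑ l ∈ Fintype.piFinset fun _ : Fin d => Finset.range (n + 1),
          ∑ q ∈ Finset.range N, boxPiece n α u v l q := by
  classical
  have h1 : Nat.card {q : ℕ // q < N ∧ ∀ i, u i ≤ Int.fract (q * α i) ∧ Int.fract (q * α i) < v i}
      = ((Finset.range N).filter fun q : ℕ =>
          ∀ i, u i ≤ Int.fract (q * α i) ∧ Int.fract (q * α i) < v i).card :=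
    Nat.subtype_card _ (by simp)
  rw [h1, Finset.sum_comm, Finset.card_filter]
  push_cast
  refine Finset.sum_congr rfl fun q _ => ?_
  simp only [boxPiece]
  rw [← Finset.prod_univ_sum (fun _ => Finset.range (n + 1))
    fun i l => piece n (u i) (v i) l (q * α i)]
  rw [Finset.prod_congr rfl fun i _ => sum_piece n (hb i).1 (hb i).2.1 (hb i).2.2 (q * α i),
    Finset.prod_ite_zero]
  simp

theorem sum_pieceMean {d : ℕ} (n : ℕ) (u v : Fin d → ℝ) :
    ∑ l ∈ Fintype.piFinset fun _ : Fin d => Finset.range (n + 1), pieceMean u v l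
      = ∏ i, (v i - u i) := by
  simp only [pieceMean]
  rw [← Finset.prod_univ_sum (fun _ => Finset.range (n + 1))
    fun i l => if l = 0 then v i - u i else 0]
  simp

theorem abs_card_sub_le {d n : ℕ} (hn : 1 ≤ n) (α : Fin d → ℝ) {u v : Fin d → ℝ}
    (hb : ∀ i, 0 ≤ u i ∧ u i ≤ v i ∧ v i ≤ 1) (N : ℕ) (hN : N ≤ 2 ^ n)
    (hx : ∀ h ∈ box d (4 ^ n), h ≠ 0 → lin h (fun i => (α i : UnitAddCircle)) ≠ 0) :
    |(Nat.card {q : ℕ // q < N ∧ ∀ i, u i ≤ Int.fract (q * α i) ∧ Int.fract (q * α i) < v i} : ℝ)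
        - N * ∏ i, (v i - u i)|
      ≤ (2 * 6 ^ d + 2 * d * 4 ^ d) * ∑ l ∈ Fintype.piFinset fun _ : Fin d => Finset.range (n + 1),
          (closeCount (fun i => (α i : UnitAddCircle)) (2 ^ min (∑ i, l i) n) l : ℝ) +
        17 ^ d * ∑ h ∈ (box d (4 ^ n)).erase 0,
          decay (height h * ‖lin h (fun i => (α i : UnitAddCircle))‖) := by
  classical
  set x : Fin d → UnitAddCircle := fun i => (α i : UnitAddCircle) with hxdef
  set R : (Fin d → ℕ) → ℝ := fun l =>
    ∑ h ∈ (box d (4 ^ n)).erase 0, (∏ i, coeffBound (l i) (h i)) *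
          (min 1 (1 / (((2 ^ ∑ i, l i : ℕ) : ℝ) * ‖lin h x‖)) / ‖lin h x‖) with hR
  have hR0 : ∀ l, 0 ≤ R l := fun l => Finset.sum_nonneg fun h _ =>
    mul_nonneg (Finset.prod_nonneg fun i _ => coeffBound_nonneg _ _) (by positivity)
  rw [card_eq_sum_boxPiece n α hb, ← sum_pieceMean n u v, Finset.mul_sum, ← Finset.sum_sub_distrib]
  have hterm : ∀ l ∈ Fintype.piFinset fun _ : Fin d => Finset.range (n + 1),
      |∑ q ∈ Finset.range N, boxPiece n α u v l q - N * pieceMean u v l|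
      ≤ (2 * 6 ^ d + 2 * d * 4 ^ d) * (closeCount x (2 ^ min (∑ i, l i) n) l : ℝ)
        + if l ∈ Fintype.piFinset fun _ : Fin d => Finset.range n then R l else 0 := by
    intro l hl
    rw [Fintype.mem_piFinset] at hl
    have hl' : ∀ i, l i ≤ n := fun i => by have := Finset.mem_range.1 (hl i); omega
    rcases le_or_gt n (∑ i, l i) with hs | hs
    · have hm : pieceMean u v l = 0 := by
        have : ∃ i, l i ≠ 0 := by
          by_contra hcon
          push Not at hcon
          simp [hcon] at hs
          omega
        obtain ⟨i, hi⟩ := this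
        exact Finset.prod_eq_zero (Finset.mem_univ i) (if_neg hi)
      rw [hm, mul_zero, sub_zero, min_eq_right hs]
      have h1 := abs_sum_boxPiece_le α hb l hl' 0 (2 ^ n) (Finset.range N)
        (by rw [Finset.range_eq_Ico]; exact Finset.Ico_subset_Ico_right (by omega))
      have h2 : (0 : ℝ) ≤ if l ∈ Fintype.piFinset fun _ : Fin d => Finset.range n then R l else 0 := by
        split_ifs
        · exact hR0 l
        · exact le_rfl
      have h3 : (0 : ℝ) ≤ (6 ^ d + 2 * d * 4 ^ d) * closeCount x (2 ^ n) l := by positivity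
      linarith
    · have hlt : ∀ i, l i < n := fun i =>
        lt_of_le_of_lt (Finset.single_le_sum (fun j _ => Nat.zero_le (l j)) (Finset.mem_univ i)) hs
      rw [min_eq_left hs.le, if_pos (by simpa [Fintype.mem_piFinset] using hlt)]
      exact abs_sum_boxPiece_sub_mean_le hn α hb l hlt N hN hx
  refine (Finset.abs_sum_le_sum_abs _ _).trans ((Finset.sum_le_sum hterm).trans ?_)
  rw [Finset.sum_add_distrib, ← Finset.mul_sum]
  gcongr
  rw [← Finset.sum_filter]
  have hsub : (Fintype.piFinset fun _ : Fin d => Finset.range (n + 1)).filter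
      (fun l => l ∈ Fintype.piFinset fun _ : Fin d => Finset.range n)
      ⊆ Fintype.piFinset fun _ : Fin d => Finset.range n := fun l hl => (Finset.mem_filter.1 hl).2
  refine (Finset.sum_le_sum_of_subset_of_nonneg hsub fun l _ _ => hR0 l).trans ?_
  rw [hR, Finset.sum_comm, Finset.mul_sum]
  refine Finset.sum_le_sum fun h hh => ?_
  obtain ⟨hne, hmem⟩ := Finset.mem_erase.1 hh
  exact sum_scales_le n h (norm_pos_iff.2 (hx h hmem hne))

instance isProbabilityMeasure_circle : IsProbabilityMeasure (volume : Measure UnitAddCircle) :=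
  ⟨UnitAddCircle.measure_univ⟩

instance isProbabilityMeasure_torus (d : ℕ) :
    IsProbabilityMeasure (volume : Measure (Fin d → UnitAddCircle)) :=
  inferInstanceAs (IsProbabilityMeasure (Measure.pi fun _ : Fin d => (volume : Measure UnitAddCircle)))

/-- `lin h` as a group homomorphism. -/
noncomputable def linHom {d : ℕ} (h : Fin d → ℤ) : (Fin d → UnitAddCircle) →+ UnitAddCircle where
  toFun := lin h
  map_zero' := by simp [lin]
  map_add' x y := by simp [lin, Finset.sum_add_distrib]

theorem continuous_lin {d : ℕ} (h : Fin d → ℤ) : Continuous (lin h) := by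
  unfold lin; fun_prop

theorem lin_single {d : ℕ} (h : Fin d → ℤ) (i : Fin d) (z : UnitAddCircle) :
    lin h (Pi.single i z) = h i • z := by
  rw [lin, Finset.sum_eq_single i]
  · simp
  · intro j _ hj; simp [hj]
  · simp

theorem lin_add {d : ℕ} (h : Fin d → ℤ) (x y : Fin d → UnitAddCircle) :
    lin h (x + y) = lin h x + lin h y := (linHom h).map_add x y

theorem lin_surjective {d : ℕ} {h : Fin d → ℤ} (hh : h ≠ 0) : Function.Surjective (lin h) := by
  obtain ⟨i, hi⟩ := Function.ne_iff.1 hh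
  intro y
  induction y using QuotientAddGroup.induction_on with
  | H t =>
    refine ⟨Pi.single i ((t / h i : ℝ) : UnitAddCircle), ?_⟩
    rw [lin_single, ← AddCircle.coe_zsmul, zsmul_eq_mul, mul_div_cancel₀]
    exact_mod_cast hi

theorem measurePreserving_lin {d : ℕ} {h : Fin d → ℤ} (hh : h ≠ 0) :
    MeasurePreserving (lin h) volume volume :=
  AddMonoidHom.measurePreserving (f := linHom h) (continuous_lin h) (lin_surjective hh) (by simp)

theorem volume_real_closedBall {δ : ℝ} (h0 : 0 ≤ δ) (h1 : δ ≤ 1 / 2) :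
    volume.real (Metric.closedBall (0 : UnitAddCircle) δ) = 2 * δ := by
  rw [Measure.real, AddCircle.volume_closedBall, min_eq_right (by linarith),
    ENNReal.toReal_ofReal (by linarith)]

theorem volume_real_closedBall_le (y : UnitAddCircle) {δ : ℝ} (h0 : 0 ≤ δ) :
    volume.real (Metric.closedBall y δ) ≤ 2 * δ := by
  rw [Measure.real, AddCircle.volume_closedBall]
  refine ENNReal.toReal_le_of_le_ofReal (by linarith) (ENNReal.ofReal_le_ofReal (min_le_right _ _))

theorem measurableSet_lin_le {d : ℕ} (h : Fin d → ℤ) (δ : ℝ) :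
    MeasurableSet {x : Fin d → UnitAddCircle | ‖lin h x‖ ≤ δ} :=
  (isClosed_le (continuous_lin h).norm continuous_const).measurableSet

theorem measure_lin_le_eq {d : ℕ} {h : Fin d → ℤ} (hh : h ≠ 0) (δ : ℝ) :
    volume.real {x : Fin d → UnitAddCircle | ‖lin h x‖ ≤ δ}
      = volume.real (Metric.closedBall (0 : UnitAddCircle) δ) := by
  rw [← (measurePreserving_lin hh).measureReal_preimage
    Metric.isClosed_closedBall.measurableSet.nullMeasurableSet]
  congr 1
  ext x
  simp

theorem measure_lin_le {d : ℕ} {h : Fin d → ℤ} (hh : h ≠ 0) {δ : ℝ} (h0 : 0 ≤ δ) :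
    volume.real {x : Fin d → UnitAddCircle | ‖lin h x‖ ≤ δ} ≤ 2 * δ :=
  (measure_lin_le_eq hh δ).trans_le (volume_real_closedBall_le 0 h0)

theorem measure_pair_of_nonparallel {d : ℕ} {h h' : Fin d → ℤ} {i j : Fin d}
    (hij : h i * h' j ≠ h j * h' i) {δ δ' : ℝ} (h0 : 0 ≤ δ) (h0' : 0 ≤ δ') :
    volume.real ({x : Fin d → UnitAddCircle | ‖lin h x‖ ≤ δ} ∩ {x | ‖lin h' x‖ ≤ δ'})
      ≤ 4 * δ * δ' := by
  have : (volume : Measure (UnitAddCircle × UnitAddCircle)).IsAddHaarMeasure :=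
    inferInstanceAs ((volume : Measure UnitAddCircle).prod volume).IsAddHaarMeasure
  have : IsProbabilityMeasure (volume : Measure (UnitAddCircle × UnitAddCircle)) :=
    inferInstanceAs (IsProbabilityMeasure ((volume : Measure UnitAddCircle).prod volume))
  have hsurj : Function.Surjective ((linHom h).prod (linHom h')) := by
    rintro ⟨y, y'⟩
    induction y using QuotientAddGroup.induction_on with
    | H t =>
    induction y' using QuotientAddGroup.induction_on with
    | H t' =>
    set D : ℝ := h i * h' j - h j * h' i with hD
    have hD0 : D ≠ 0 := by
      rw [hD, sub_ne_zero]; exact_mod_cast hij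
    set a : ℝ := (t * h' j - h j * t') / D with ha
    set b : ℝ := (h i * t' - t * h' i) / D with hb
    have hlin : ∀ g : Fin d → ℤ, lin g (Pi.single i (a : UnitAddCircle) + Pi.single j (b : UnitAddCircle))
        = ((g i * a + g j * b : ℝ) : UnitAddCircle) := by
      intro g
      rw [lin_add, lin_single, lin_single, ← AddCircle.coe_zsmul, ← AddCircle.coe_zsmul,
        ← AddCircle.coe_add, zsmul_eq_mul, zsmul_eq_mul]
    refine ⟨Pi.single i (a : UnitAddCircle) + Pi.single j (b : UnitAddCircle), ?_⟩
    refine Prod.ext ?_ ?_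
    · change lin h _ = _
      rw [hlin]
      change _ = ((t : ℝ) : UnitAddCircle)
      congr 1
      rw [ha, hb]; field_simp; rw [hD]; ring
    · change lin h' _ = _
      rw [hlin]
      change _ = ((t' : ℝ) : UnitAddCircle)
      congr 1
      rw [ha, hb]; field_simp; rw [hD]; ring
  have hcont : Continuous ((linHom h).prod (linHom h')) :=
    (continuous_lin h).prodMk (continuous_lin h')
  have hmp : MeasurePreserving ((linHom h).prod (linHom h')) volume volume :=
    AddMonoidHom.measurePreserving hcont hsurj (by simp)
  have hset : {x : Fin d → UnitAddCircle | ‖lin h x‖ ≤ δ} ∩ {x | ‖lin h' x‖ ≤ δ'}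
      = ((linHom h).prod (linHom h')) ⁻¹'
        (Metric.closedBall (0 : UnitAddCircle) δ ×ˢ Metric.closedBall (0 : UnitAddCircle) δ') := by
    ext x
    simp only [Set.mem_inter_iff, Set.mem_ofPred_eq, Set.mem_preimage, Set.mem_prod,
      mem_closedBall_zero_iff]
    rfl
  rw [hset, hmp.measureReal_preimage
    (Metric.isClosed_closedBall.prod Metric.isClosed_closedBall).measurableSet.nullMeasurableSet]
  have : (volume : Measure (UnitAddCircle × UnitAddCircle)).real
      (Metric.closedBall (0 : UnitAddCircle) δ ×ˢ Metric.closedBall (0 : UnitAddCircle) δ')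
      = volume.real (Metric.closedBall (0 : UnitAddCircle) δ)
        * volume.real (Metric.closedBall (0 : UnitAddCircle) δ') := measureReal_prod_prod _ _
  rw [this]
  calc _ ≤ (2 * δ) * (2 * δ') := by
        gcongr
        · exact volume_real_closedBall_le 0 h0
        · exact volume_real_closedBall_le 0 h0'
    _ = _ := by ring

theorem exists_common_direction {d : ℕ} {h h' : Fin d → ℤ} (hh : h ≠ 0) (hh' : h' ≠ 0)
    (hpar : ∀ i j, h i * h' j = h j * h' i) :
    ∃ (a b : ℤ) (w : Fin d → ℤ), IsCoprime a b ∧ a ≠ 0 ∧ b ≠ 0 ∧ w ≠ 0 ∧ h = a • w ∧ h' = b • w := by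
  obtain ⟨i, hi⟩ := Function.ne_iff.1 hh
  simp only [Pi.zero_apply] at hi
  have hi' : h' i ≠ 0 := by
    intro h0
    apply hh'
    funext j
    have := hpar i j
    rw [h0, mul_zero] at this
    exact (mul_eq_zero.1 this).resolve_left hi
  have hg : 0 < Int.gcd (h i) (h' i) := Int.gcd_pos_of_ne_zero_left _ hi
  obtain ⟨g, a, b, hg0, hab, ha, hb⟩ := Int.exists_gcd_one' hg
  have hg0' : (g : ℤ) ≠ 0 := by exact_mod_cast hg0.ne'
  have ha0 : a ≠ 0 := by rintro rfl; simp at ha; exact hi ha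
  have hb0 : b ≠ 0 := by rintro rfl; simp at hb; exact hi' hb
  have hcop : IsCoprime a b := Int.isCoprime_iff_gcd_eq_one.2 hab
  have hrel : ∀ j, a * h' j = h j * b := by
    intro j
    have := hpar i j
    rw [ha, hb] at this
    apply mul_right_cancel₀ hg0'
    linear_combination this
  have hdiv : ∀ j, a ∣ h j := fun j => hcop.dvd_of_dvd_mul_right ⟨h' j, (hrel j).symm⟩
  choose w hw using hdiv
  refine ⟨a, b, w, hcop, ha0, hb0, ?_, funext fun j => by simp [hw], funext fun j => ?_⟩
  · rintro rfl
    exact hi (by rw [hw]; simp)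
  · have := hrel j
    rw [hw] at this
    apply mul_left_cancel₀ ha0
    rw [Pi.smul_apply, smul_eq_mul]
    linear_combination this

theorem sum_Icc_erase_zero {M : Type*} [AddCommMonoid M] (m : ℕ) (f : ℤ → M) :
    ∑ k ∈ (Finset.Icc (-(m : ℤ)) m).erase 0, f k
      = ∑ i ∈ Finset.Icc 1 m, f i + ∑ i ∈ Finset.Icc 1 m, f (-(i : ℤ)) := by
  have e : (Finset.Icc (-(m : ℤ)) m).erase 0 = (Finset.Icc 1 m).image (fun i : ℕ => (i : ℤ)) ∪
      (Finset.Icc 1 m).image (fun i : ℕ => -(i : ℤ)) := by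
    ext k
    simp only [Finset.mem_erase, Finset.mem_Icc, Finset.mem_union, Finset.mem_image]
    constructor
    · rintro ⟨h0, h1, h2⟩
      rcases lt_or_gt_of_ne h0 with h | h
      · exact Or.inr ⟨k.natAbs, by omega, by omega⟩
      · exact Or.inl ⟨k.natAbs, by omega, by omega⟩
    · rintro (⟨i, hi, rfl⟩ | ⟨i, hi, rfl⟩) <;> omega
  rw [e, Finset.sum_union, Finset.sum_image, Finset.sum_image]
  · intro i _ j _ h; simpa using h
  · intro i _ j _ h; simpa using h
  · rw [Finset.disjoint_left]
    intro k hk hk'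
    simp only [Finset.mem_image, Finset.mem_Icc] at hk hk'
    omega

/-- The length of the intersection of `[t - A, t + A]` and `[-B, B]`. -/
noncomputable def overlap (A B t : ℝ) : ℝ := max 0 (min (t + A) B - max (t - A) (-B))

theorem overlap_neg (A B t : ℝ) : overlap A B (-t) = overlap A B t := by
  unfold overlap
  have h1 : max (-t - A) (-B) = -min (t + A) B := by
    rw [← max_neg_neg]; congr 1; ring
  have h2 : max (t - A) (-B) = -min (-t + A) B := by
    rw [← max_neg_neg]; congr 1; ring
  rw [h1, h2]
  congr 1
  ring

theorem overlap_mul_le {A B t η : ℝ} (hA : 0 ≤ A) (hB : 0 ≤ B) (hη : 0 ≤ η) (ht : η ≤ t) :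
    η * overlap A B t ≤ (max 0 (A + B - (t - η)) ^ 2 - max 0 (|A - B| - (t - η)) ^ 2) / 2
      - (max 0 (A + B - t) ^ 2 - max 0 (|A - B| - t) ^ 2) / 2 := by
  have ht0 : 0 ≤ t := hη.trans ht
  have h1 : overlap A B t ≤ max 0 (A + B - t) - max 0 (|A - B| - t) := by
    unfold overlap
    rcases abs_cases (A - B) with ⟨h, h'⟩ | ⟨h, h'⟩ <;> rw [h] <;>
    · refine max_le ?_ ?_
      · rw [sub_nonneg]; exact max_le_max le_rfl (by linarith)
      · rcases le_total (t + A) B with c1 | c1 <;> rcases le_total (t - A) (-B) with c2 | c2 <;>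
        simp only [min_eq_left c1, min_eq_right c1, max_eq_left c2, max_eq_right c2] <;>
        rcases max_cases 0 (A + B - t) with ⟨c3, c3'⟩ | ⟨c3, c3'⟩ <;> rw [c3] <;>
        first
        | rcases max_cases 0 (A - B - t) with ⟨c4, c4'⟩ | ⟨c4, c4'⟩ <;> rw [c4] <;> linarith
        | rcases max_cases 0 (-(A - B) - t) with ⟨c4, c4'⟩ | ⟨c4, c4'⟩ <;> rw [c4] <;> linarith
  have hD : |A - B| ≤ A + B := by rw [abs_le]; constructor <;> linarith
  refine (mul_le_mul_of_nonneg_left h1 hη).trans ?_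
  generalize |A - B| = D at *
  rcases max_cases 0 (A + B - t) with ⟨c1, d1⟩ | ⟨c1, d1⟩ <;>
  rcases max_cases 0 (D - t) with ⟨c2, d2⟩ | ⟨c2, d2⟩ <;>
  rcases max_cases 0 (A + B - (t - η)) with ⟨c3, d3⟩ | ⟨c3, d3⟩ <;>
  rcases max_cases 0 (D - (t - η)) with ⟨c4, d4⟩ | ⟨c4, d4⟩ <;>
  rw [c1, c2, c3, c4] <;> nlinarith

theorem sum_overlap_le {A B η : ℝ} (hA : 0 ≤ A) (hB : 0 ≤ B) (hη : 0 ≤ η) (m : ℕ) :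
    η * ∑ i ∈ Finset.Icc 1 m, overlap A B (i * η) ≤ 2 * A * B := by
  have key : η * ∑ i ∈ Finset.Icc 1 m, overlap A B (i * η) ≤ 2 * A * B -
      (max 0 (A + B - m * η) ^ 2 - max 0 (|A - B| - m * η) ^ 2) / 2 := by
    induction m with
    | zero =>
      simp only [CharP.cast_eq_zero, zero_mul, sub_zero]
      rw [max_eq_right (by positivity), max_eq_right (abs_nonneg _), sq_abs]
      simp
      nlinarith
    | succ m ih =>
      rw [Finset.sum_Icc_succ_top (by omega), mul_add]
      have h := overlap_mul_le (t := ((m + 1 : ℕ) : ℝ) * η) hA hB hη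
        (by push_cast; nlinarith [(Nat.cast_nonneg m : (0 : ℝ) ≤ m)])
      have e : ((m + 1 : ℕ) : ℝ) * η - η = m * η := by push_cast; ring
      rw [e] at h
      linarith
  have hD : |A - B| ≤ A + B := by rw [abs_le]; constructor <;> linarith
  have : max 0 (|A - B| - m * η) ^ 2 ≤ max 0 (A + B - m * η) ^ 2 := by gcongr
  linarith

theorem norm_coe_le_abs (t : ℝ) : ‖(t : UnitAddCircle)‖ ≤ |t| := by
  rw [UnitAddCircle.norm_eq]
  simpa using round_le t 0

theorem measure_circle_pair_le_of_pos {a b : ℤ} (ha : 0 < a) (hb : 0 < b) (hab : IsCoprime a b)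
    {δ δ' : ℝ} (h0 : 0 ≤ δ) (h0' : 0 ≤ δ') :
    volume.real {θ : UnitAddCircle | ‖a • θ‖ ≤ δ ∧ ‖b • θ‖ ≤ δ' ∧
      ¬(‖θ‖ ≤ δ / a ∧ ‖θ‖ ≤ δ' / b)} ≤ 4 * δ * δ' := by
  have ha' : (0 : ℝ) < a := by exact_mod_cast ha
  have hb' : (0 : ℝ) < b := by exact_mod_cast hb
  set A := δ / a with hA
  set B := δ' / b with hB
  have hA0 : 0 ≤ A := by positivity
  have hB0 : 0 ≤ B := by positivity
  obtain ⟨u, v, huv⟩ := id hab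
  set lo : ℤ → ℝ := fun c => max ((c * v : ℤ) / a - A) (((-(c * u) : ℤ) : ℝ) / b - B) with hlo
  set hi : ℤ → ℝ := fun c => min ((c * v : ℤ) / a + A) (((-(c * u) : ℤ) : ℝ) / b + B) with hhi
  set m := ⌈a * b * (A + B)⌉₊ with hm
  set η : ℝ := 1 / (a * b) with hη
  have hη0 : 0 < η := by positivity
  have hlen : ∀ c : ℤ, max 0 (hi c - lo c) = overlap A B (c * η) := by
    intro c
    unfold overlap
    congr 1
    have e : ((c * v : ℤ) : ℝ) / a = ((-(c * u) : ℤ) : ℝ) / b + c * η := by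
      have : (u : ℝ) * a + v * b = 1 := by exact_mod_cast huv
      rw [hη]
      push_cast
      field_simp
      linear_combination (c : ℝ) * this
    simp only [hhi, hlo]
    rw [e]
    set w := ((-(c * u) : ℤ) : ℝ) / b
    rw [add_assoc, add_sub_assoc, min_add_add_left]
    have : max (w + (c * η - A)) (w - B) = w + max (c * η - A) (-B) := by
      rw [sub_eq_add_neg w B, max_add_add_left]
    rw [this]
    ring
  have hsub : {θ : UnitAddCircle | ‖a • θ‖ ≤ δ ∧ ‖b • θ‖ ≤ δ' ∧ ¬(‖θ‖ ≤ A ∧ ‖θ‖ ≤ B)} ⊆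
      ⋃ c ∈ (Finset.Icc (-(m : ℤ)) m).erase 0,
        Metric.closedBall (((lo c + hi c) / 2 : ℝ) : UnitAddCircle) ((hi c - lo c) / 2) := by
    rintro θ ⟨h1, h2, h3⟩
    induction θ using QuotientAddGroup.induction_on with
    | H t =>
    change ‖a • (t : UnitAddCircle)‖ ≤ δ at h1
    change ‖b • (t : UnitAddCircle)‖ ≤ δ' at h2
    change ¬(‖(t : UnitAddCircle)‖ ≤ A ∧ ‖(t : UnitAddCircle)‖ ≤ B) at h3
    rw [← AddCircle.coe_zsmul, UnitAddCircle.norm_eq, zsmul_eq_mul] at h1 h2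
    set p := round ((a : ℝ) * t) with hp
    set q := round ((b : ℝ) * t) with hq
    have h1' : |t - p / a| ≤ A := by
      have : t - p / a = (a * t - p) / a := by field_simp
      rw [this, abs_div, abs_of_pos ha']
      exact div_le_div_of_nonneg_right h1 ha'.le
    have h2' : |t - q / b| ≤ B := by
      have : t - q / b = (b * t - q) / b := by field_simp
      rw [this, abs_div, abs_of_pos hb']
      exact div_le_div_of_nonneg_right h2 hb'.le
    set c := p * b - q * a with hc
    -- the solutions of `p * b - q * a = c` form a single orbit
    have hk : a ∣ p - c * v := by
      have : a ∣ b * (p - c * v) := by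
        refine ⟨q + c * u, ?_⟩
        linear_combination (-c) * huv + hc
      exact hab.dvd_of_dvd_mul_left this
    obtain ⟨k, hk⟩ := hk
    have hk2 : q + c * u = b * k := by
      have : a * (q + c * u) = a * (b * k) := by
        linear_combination c * huv - hc + b * hk
      exact mul_left_cancel₀ ha.ne' this
    have hpk : (p : ℝ) / a = ((c * v : ℤ) : ℝ) / a + k := by
      have : (p : ℝ) = ((c * v : ℤ) : ℝ) + a * k := by
        have : p = c * v + a * k := by linarith
        exact_mod_cast this
      rw [this]; field_simp
    have hqk : (q : ℝ) / b = ((-(c * u) : ℤ) : ℝ) / b + k := by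
      have : (q : ℝ) = ((-(c * u) : ℤ) : ℝ) + b * k := by
        have : q = -(c * u) + b * k := by linarith
        exact_mod_cast this
      rw [this]; field_simp
    have htk : ((t - k : ℝ) : UnitAddCircle) = (t : UnitAddCircle) := by
      rw [AddCircle.coe_sub, coe_intCast_eq_zero, sub_zero]
    rw [hpk] at h1'
    rw [hqk] at h2'
    have hl1 := abs_le.1 h1'
    have hl2 := abs_le.1 h2'
    have hc0 : c ≠ 0 := by
      intro hc0
      rw [hc0] at h1' h2'
      apply h3
      rw [← htk]
      constructor
      · refine (norm_coe_le_abs _).trans ?_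
        simpa using h1'
      · refine (norm_coe_le_abs _).trans ?_
        simpa using h2'
    have hcm : |c| ≤ m := by
      have : (c : ℝ) * η = (t - q / b) - (t - p / a) := by
        rw [hc, hη]; push_cast; field_simp; ring
      rw [hpk, hqk] at this
      have h5 : |(c : ℝ)| * η ≤ A + B := by
        rw [← abs_of_pos hη0, ← abs_mul, this, abs_le]
        constructor <;> linarith
      have h6 : |(c : ℝ)| ≤ m := by
        refine le_trans ?_ (Nat.le_ceil _)
        rw [hη, mul_one_div, div_le_iff₀ (by positivity)] at h5
        linarith
      exact_mod_cast h6
    simp only [Set.mem_iUnion]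
    refine ⟨c, Finset.mem_erase.2 ⟨hc0, Finset.mem_Icc.2 (abs_le.1 hcm)⟩, ?_⟩
    rw [mem_closedBall_iff_norm]
    change ‖(t : UnitAddCircle) - _‖ ≤ _
    rw [← htk, ← AddCircle.coe_sub]
    refine (norm_coe_le_abs _).trans ?_
    have hle : lo c ≤ t - k := max_le (by linarith) (by linarith)
    have hge : t - k ≤ hi c := le_min (by linarith) (by linarith)
    rw [abs_le]
    constructor <;> linarith
  calc _ ≤ ∑ c ∈ (Finset.Icc (-(m : ℤ)) m).erase 0, volume.real
        (Metric.closedBall (((lo c + hi c) / 2 : ℝ) : UnitAddCircle) ((hi c - lo c) / 2)) :=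
        (measureReal_mono hsub (measure_ne_top _ _)).trans (measureReal_biUnion_finset_le _ _)
    _ ≤ ∑ c ∈ (Finset.Icc (-(m : ℤ)) m).erase 0, overlap A B (c * η) := by
        refine Finset.sum_le_sum fun c _ => ?_
        rw [← hlen]
        rcases le_or_gt 0 (hi c - lo c) with h | h
        · refine (volume_real_closedBall_le _ (by linarith)).trans ?_
          refine le_trans ?_ (le_max_right _ _)
          linarith
        · rw [Metric.closedBall_eq_empty.2 (by linarith)]
          simp
    _ = 2 * ∑ i ∈ Finset.Icc 1 m, overlap A B (i * η) := by
        rw [sum_Icc_erase_zero]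
        push_cast
        simp only [neg_mul, overlap_neg]
        ring
    _ ≤ 4 * δ * δ' := by
        have h := sum_overlap_le hA0 hB0 hη0.le m
        have e1 : (a * b : ℝ) * η = 1 := by rw [hη]; field_simp
        have e : (a * b * (2 * A * B) : ℝ) = 2 * δ * δ' := by rw [hA, hB]; field_simp
        calc _ = 2 * (a * b * η * ∑ i ∈ Finset.Icc 1 m, overlap A B (i * η)) := by rw [e1, one_mul]
          _ = 2 * (a * b * (η * ∑ i ∈ Finset.Icc 1 m, overlap A B (i * η))) := by ring
          _ ≤ 2 * (a * b * (2 * A * B)) := by gcongr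
          _ = _ := by rw [e]; ring

theorem norm_abs_zsmul (a : ℤ) (θ : UnitAddCircle) : ‖|a| • θ‖ = ‖a • θ‖ := by
  rcases abs_choice a with h | h <;> rw [h]
  rw [neg_smul, norm_neg]

theorem measure_circle_pair_le {a b : ℤ} (ha : a ≠ 0) (hb : b ≠ 0) (hab : IsCoprime a b)
    {δ δ' : ℝ} (h0 : 0 ≤ δ) (h0' : 0 ≤ δ') :
    volume.real {θ : UnitAddCircle | ‖a • θ‖ ≤ δ ∧ ‖b • θ‖ ≤ δ' ∧
      ¬(‖θ‖ ≤ δ / |(a : ℝ)| ∧ ‖θ‖ ≤ δ' / |(b : ℝ)|)} ≤ 4 * δ * δ' := by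
  have h := measure_circle_pair_le_of_pos (abs_pos.2 ha) (abs_pos.2 hb)
    (IsCoprime.abs_abs hab) h0 h0'
  simp only [norm_abs_zsmul] at h
  push_cast at h
  exact h

theorem lin_smul {d : ℕ} (a : ℤ) (w : Fin d → ℤ) (x : Fin d → UnitAddCircle) :
    lin (a • w) x = a • lin w x := by
  simp [lin, Finset.smul_sum, mul_smul]

theorem measure_pair_of_parallel {d : ℕ} {w : Fin d → ℤ} (hw : w ≠ 0) {a b : ℤ} (ha : a ≠ 0)
    (hb : b ≠ 0) (hab : IsCoprime a b) {δ δ' : ℝ} (h0 : 0 ≤ δ) (h0' : 0 ≤ δ') :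
    volume.real {x : Fin d → UnitAddCircle | ‖lin (a • w) x‖ ≤ δ ∧ ‖lin (b • w) x‖ ≤ δ' ∧
      ¬(‖lin w x‖ ≤ δ / |(a : ℝ)| ∧ ‖lin w x‖ ≤ δ' / |(b : ℝ)|)} ≤ 4 * δ * δ' := by
  have hmeas : MeasurableSet {θ : UnitAddCircle | ‖a • θ‖ ≤ δ ∧ ‖b • θ‖ ≤ δ' ∧
      ¬(‖θ‖ ≤ δ / |(a : ℝ)| ∧ ‖θ‖ ≤ δ' / |(b : ℝ)|)} := by
    have hle : ∀ (c : ℤ) (r : ℝ), MeasurableSet {θ : UnitAddCircle | ‖c • θ‖ ≤ r} := fun c r =>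
      (isClosed_le (by fun_prop) continuous_const).measurableSet
    have hle' : ∀ r : ℝ, MeasurableSet {θ : UnitAddCircle | ‖θ‖ ≤ r} := fun r =>
      (isClosed_le (by fun_prop) continuous_const).measurableSet
    exact (hle a δ).inter ((hle b δ').inter ((hle' _).inter (hle' _)).compl)
  have h := (measurePreserving_lin hw).measureReal_preimage hmeas.nullMeasurableSet
  simp only [lin_smul]
  exact h.trans_le (measure_circle_pair_le ha hb hab h0 h0')

/-- Half-width of the strip attached to the frequency `h` at scale `s`. -/
noncomputable def width {d : ℕ} (h : Fin d → ℤ) (s : ℕ) : ℝ := (1 / 2) ^ s / height h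

theorem width_pos {d : ℕ} (h : Fin d → ℤ) (s : ℕ) : 0 < width h s :=
  div_pos (by positivity) (height_pos h)

/-- Points resonant with the frequency `h` at scale `s`. -/
def strip {d : ℕ} (h : Fin d → ℤ) (s : ℕ) : Set (Fin d → UnitAddCircle) :=
  {x | ‖lin h x‖ ≤ width h s}

/-- Points whose resonance with `h = g • w` comes from `w`, for some large `g`. -/
def imprimitive {d : ℕ} (A H : ℕ) (h : Fin d → ℤ) (s : ℕ) : Set (Fin d → UnitAddCircle) :=
  ⋃ p ∈ ((Finset.Icc (-(H : ℤ)) H ×ˢ (box d H).erase 0).filter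
    fun p => (A : ℤ) < |p.1| ∧ h = p.1 • p.2), {x | ‖lin p.2 x‖ ≤ width h s / |(p.1 : ℝ)|}

theorem measurableSet_strip {d : ℕ} (h : Fin d → ℤ) (s : ℕ) : MeasurableSet (strip h s) :=
  measurableSet_lin_le h _

theorem measurableSet_imprimitive {d : ℕ} (A H : ℕ) (h : Fin d → ℤ) (s : ℕ) :
    MeasurableSet (imprimitive A H h s) :=
  Finset.measurableSet_biUnion _ fun p _ => measurableSet_lin_le p.2 _

/-- Contribution of parallel frequencies to pair correlations. -/
noncomputable def parallelTerm {d : ℕ} (A H : ℕ) (h h' : Fin d → ℤ) (s s' : ℕ) : ℝ :=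
  ∑ p ∈ (Finset.Icc (-(A : ℤ)) A).erase 0 ×ˢ (Finset.Icc (-(A : ℤ)) A).erase 0 ×ˢ (box d H).erase 0,
    if h = p.1 • p.2.2 ∧ h' = p.2.1 • p.2.2 then
      2 * min (width h s / |(p.1 : ℝ)|) (width h' s' / |(p.2.1 : ℝ)|) else 0

theorem parallelTerm_summand_nonneg {d : ℕ} (h h' : Fin d → ℤ) (s s' : ℕ)
    (p : ℤ × ℤ × (Fin d → ℤ)) :
    0 ≤ if h = p.1 • p.2.2 ∧ h' = p.2.1 • p.2.2 then
      2 * min (width h s / |(p.1 : ℝ)|) (width h' s' / |(p.2.1 : ℝ)|) else 0 := by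
  have := (width_pos h s).le
  have := (width_pos h' s').le
  split_ifs <;> positivity

theorem abs_le_of_smul_mem_box {d H : ℕ} {a : ℤ} {w : Fin d → ℤ} (hw : w ≠ 0)
    (h : a • w ∈ box d H) : |a| ≤ H := by
  obtain ⟨i, hi⟩ := Function.ne_iff.1 hw
  have h1 := mem_box.1 h i
  rw [Pi.smul_apply, smul_eq_mul, abs_mul] at h1
  exact (le_mul_of_one_le_right (abs_nonneg a) (Int.one_le_abs hi)).trans h1

theorem mem_box_of_smul_mem_box {d H : ℕ} {a : ℤ} (ha : a ≠ 0) {w : Fin d → ℤ}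
    (h : a • w ∈ box d H) : w ∈ box d H := by
  refine mem_box.2 fun i => ?_
  have h1 := mem_box.1 h i
  rw [Pi.smul_apply, smul_eq_mul, abs_mul] at h1
  exact (le_mul_of_one_le_left (abs_nonneg (w i)) (Int.one_le_abs ha)).trans h1

theorem mem_imprimitive {d A H : ℕ} {a : ℤ} {w : Fin d → ℤ} (hw : w ≠ 0)
    (h : a • w ∈ box d H) (ha : (A : ℤ) < |a|) {s : ℕ} {x : Fin d → UnitAddCircle}
    (hx : ‖lin w x‖ ≤ width (a • w) s / |(a : ℝ)|) : x ∈ imprimitive A H (a • w) s := by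
  have ha0 : a ≠ 0 := by
    rintro rfl
    simp at ha
    omega
  simp only [imprimitive, Set.mem_iUnion]
  refine ⟨(a, w), Finset.mem_filter.2 ⟨Finset.mem_product.2 ⟨?_, ?_⟩, ha, rfl⟩, hx⟩
  · exact Finset.mem_Icc.2 (abs_le.1 (abs_le_of_smul_mem_box hw h))
  · exact Finset.mem_erase.2 ⟨hw, mem_box_of_smul_mem_box ha0 h⟩

theorem measure_strip_pair_le {d A H : ℕ} {h h' : Fin d → ℤ} (hh : h ∈ (box d H).erase 0)
    (hh' : h' ∈ (box d H).erase 0) (s s' : ℕ) :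
    volume.real ((strip h s \ imprimitive A H h s) ∩ (strip h' s' \ imprimitive A H h' s'))
      ≤ 4 * width h s * width h' s' + parallelTerm A H h h' s s' := by
  obtain ⟨hne, hmem⟩ := Finset.mem_erase.1 hh
  obtain ⟨hne', hmem'⟩ := Finset.mem_erase.1 hh'
  have hδ := (width_pos h s).le
  have hδ' := (width_pos h' s').le
  have hP : 0 ≤ parallelTerm A H h h' s s' :=
    Finset.sum_nonneg fun p _ => parallelTerm_summand_nonneg h h' s s' p
  by_cases hpar : ∀ i j, h i * h' j = h j * h' i
  · obtain ⟨a, b, w, hab, ha, hb, hw, rfl, rfl⟩ := exists_common_direction hne hne' hpar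
    have h1 := measure_pair_of_parallel hw ha hb hab hδ hδ'
    set X := {x : Fin d → UnitAddCircle | ‖lin (a • w) x‖ ≤ width (a • w) s ∧
      ‖lin (b • w) x‖ ≤ width (b • w) s' ∧
      ¬(‖lin w x‖ ≤ width (a • w) s / |(a : ℝ)| ∧ ‖lin w x‖ ≤ width (b • w) s' / |(b : ℝ)|)}
    by_cases hA : |a| ≤ A ∧ |b| ≤ A
    · set m := min (width (a • w) s / |(a : ℝ)|) (width (b • w) s' / |(b : ℝ)|)
      have hsub : (strip (a • w) s \ imprimitive A H (a • w) s) ∩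
          (strip (b • w) s' \ imprimitive A H (b • w) s') ⊆ X ∪ {x | ‖lin w x‖ ≤ m} := by
        rintro x ⟨⟨hx1, -⟩, hx2, -⟩
        by_cases hc : ‖lin w x‖ ≤ width (a • w) s / |(a : ℝ)| ∧
          ‖lin w x‖ ≤ width (b • w) s' / |(b : ℝ)|
        · exact Or.inr (le_min hc.1 hc.2)
        · exact Or.inl ⟨hx1, hx2, hc⟩
      have h2 : volume.real {x : Fin d → UnitAddCircle | ‖lin w x‖ ≤ m} ≤ 2 * m :=
        measure_lin_le hw (by positivity)
      have h3 : 2 * m ≤ parallelTerm A H (a • w) (b • w) s s' := by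
        have hp : (a, b, w) ∈ (Finset.Icc (-(A : ℤ)) A).erase 0 ×ˢ
            (Finset.Icc (-(A : ℤ)) A).erase 0 ×ˢ (box d H).erase 0 := by
          simp only [Finset.mem_product, Finset.mem_erase, Finset.mem_Icc]
          exact ⟨⟨ha, abs_le.1 hA.1⟩, ⟨hb, abs_le.1 hA.2⟩, hw, mem_box_of_smul_mem_box ha hmem⟩
        have := Finset.single_le_sum
          (fun p _ => parallelTerm_summand_nonneg (a • w) (b • w) s s' p) hp
        rw [if_pos ⟨rfl, rfl⟩] at this
        exact this
      calc _ ≤ volume.real (X ∪ {x | ‖lin w x‖ ≤ m}) := measureReal_mono hsub (measure_ne_top _ _)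
        _ ≤ _ := (measureReal_union_le _ _).trans (add_le_add h1 (h2.trans h3))
    · have hsub : (strip (a • w) s \ imprimitive A H (a • w) s) ∩
          (strip (b • w) s' \ imprimitive A H (b • w) s') ⊆ X := by
        rintro x ⟨⟨hx1, hx1'⟩, hx2, hx2'⟩
        refine ⟨hx1, hx2, fun hc => hA ⟨?_, ?_⟩⟩
        · by_contra hcon
          exact hx1' (mem_imprimitive hw hmem (not_le.1 hcon) hc.1)
        · by_contra hcon
          exact hx2' (mem_imprimitive hw hmem' (not_le.1 hcon) hc.2)
      have := (measureReal_mono hsub (measure_ne_top _ _)).trans h1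
      linarith
  · push Not at hpar
    obtain ⟨i, j, hij⟩ := hpar
    have hsub : (strip h s \ imprimitive A H h s) ∩ (strip h' s' \ imprimitive A H h' s') ⊆
        {x | ‖lin h x‖ ≤ width h s} ∩ {x | ‖lin h' x‖ ≤ width h' s'} :=
      Set.inter_subset_inter Set.sdiff_subset Set.sdiff_subset
    have := (measureReal_mono hsub (measure_ne_top _ _)).trans
      (measure_pair_of_nonparallel hij hδ hδ')
    linarith

theorem measure_second_moment {Ω ι : Type*} [MeasurableSpace Ω] {μ : Measure Ω}
    [IsProbabilityMeasure μ] (I : Finset ι) (w : ι → ℝ) (F : ι → Set Ω)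
    (hF : ∀ i ∈ I, MeasurableSet (F i)) {M η κ t : ℝ} (hM : 0 ≤ M) (ht : 0 < t)
    (h1 : M - η ≤ ∑ i ∈ I, w i * μ.real (F i))
    (h2 : ∑ i ∈ I, ∑ j ∈ I, w i * w j * μ.real (F i ∩ F j) ≤ M ^ 2 + κ) :
    μ.real {x | M + t ≤ ∑ i ∈ I, w i * (F i).indicator 1 x} ≤ (κ + 2 * M * η) / t ^ 2 := by
  have h_intble : ∀ S : Set Ω, MeasurableSet S → Integrable (S.indicator (1 : Ω → ℝ)) μ := fun S hS =>
    (integrable_const (1 : ℝ)).indicator hS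
  have hI1 : ∀ i ∈ I, Integrable (fun x => w i * (F i).indicator (1 : Ω → ℝ) x) μ :=
    fun i hi => (h_intble _ (hF i hi)).const_mul _
  have hI2 : ∀ i ∈ I, ∀ j ∈ I,
      Integrable (fun x => w i * w j * (F i ∩ F j).indicator (1 : Ω → ℝ) x) μ :=
    fun i hi j hj => (h_intble _ ((hF i hi).inter (hF j hj))).const_mul _
  set Y : Ω → ℝ := fun x => ∑ i ∈ I, w i * (F i).indicator 1 x with hY
  have hYi : Integrable Y μ := integrable_finsetSum _ hI1
  have hY1 : ∫ x, Y x ∂μ = ∑ i ∈ I, w i * μ.real (F i) := by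
    rw [hY, integral_finsetSum _ hI1]
    refine Finset.sum_congr rfl fun i hi => ?_
    rw [integral_const_mul, integral_indicator_one (hF i hi)]
  have hsq : ∀ x, Y x ^ 2 = ∑ i ∈ I, ∑ j ∈ I, w i * w j * (F i ∩ F j).indicator (1 : Ω → ℝ) x := by
    intro x
    rw [hY, sq, Finset.sum_mul_sum]
    refine Finset.sum_congr rfl fun i _ => Finset.sum_congr rfl fun j _ => ?_
    rw [Set.inter_indicator_one]
    simp only [Pi.mul_apply]
    ring
  have hY2i : Integrable (fun x => Y x ^ 2) μ := by
    simp only [hsq]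
    exact integrable_finsetSum _ fun i hi => integrable_finsetSum _ fun j hj => hI2 i hi j hj
  have hY2 : ∫ x, Y x ^ 2 ∂μ = ∑ i ∈ I, ∑ j ∈ I, w i * w j * μ.real (F i ∩ F j) := by
    simp only [hsq]
    rw [integral_finsetSum _ fun i hi => integrable_finsetSum _ fun j hj => hI2 i hi j hj]
    refine Finset.sum_congr rfl fun i hi => ?_
    rw [integral_finsetSum _ fun j hj => hI2 i hi j hj]
    refine Finset.sum_congr rfl fun j hj => ?_
    rw [integral_const_mul, integral_indicator_one ((hF i hi).inter (hF j hj))]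
  have hexp : ∀ x, (Y x - M) ^ 2 = Y x ^ 2 - 2 * M * Y x + M ^ 2 := fun x => by ring
  have hi3 : Integrable (fun x => (Y x - M) ^ 2) μ := by
    simp only [hexp]
    exact (hY2i.sub (hYi.const_mul _)).add (integrable_const _)
  have hI3 : ∫ x, (Y x - M) ^ 2 ∂μ ≤ κ + 2 * M * η := by
    simp only [hexp]
    rw [integral_add (f := fun x => Y x ^ 2 - 2 * M * Y x) (g := fun _ => M ^ 2)
        (hY2i.sub (hYi.const_mul _)) (integrable_const _),
      integral_sub (f := fun x => Y x ^ 2) (g := fun x => 2 * M * Y x) hY2i (hYi.const_mul _),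
      integral_const_mul, hY1, hY2]
    simp only [integral_const, probReal_univ, one_smul]
    nlinarith [mul_le_mul_of_nonneg_left h1 hM]
  have hmk := mul_meas_ge_le_integral_of_nonneg (μ := μ) (f := fun x => (Y x - M) ^ 2)
    (Filter.Eventually.of_forall fun x => sq_nonneg _) hi3 (t ^ 2)
  rw [le_div_iff₀ (by positivity), mul_comm]
  refine le_trans ?_ (hmk.trans hI3)
  refine mul_le_mul_of_nonneg_left (measureReal_mono ?_ (measure_ne_top _ _)) (by positivity)
  intro x hx
  have hx' : M + t ≤ Y x := hx
  change t ^ 2 ≤ (Y x - M) ^ 2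
  gcongr
  linarith

theorem decay_le_dyadic {u : ℝ} {S Q : ℕ} (hS : (1 / 2 : ℝ) ^ S ≤ u) (hQ : u ≤ 2 ^ Q) :
    decay u ≤ ∑ s ∈ Finset.Icc 1 S, 2 * (2 ^ s * if u ≤ (1 / 2) ^ s then (1 : ℝ) else 0) +
      ∑ s ∈ Finset.range (Q + 1), 4 * ((3 / 8) ^ s * if u ≤ 2 ^ s then (1 : ℝ) else 0) := by
  have hu : 0 < u := lt_of_lt_of_le (by positivity) hS
  have h1 : 0 ≤ ∑ s ∈ Finset.Icc 1 S, 2 * (2 ^ s * if u ≤ (1 / 2) ^ s then (1 : ℝ) else 0) :=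
    Finset.sum_nonneg fun s _ => by split_ifs <;> positivity
  have h2 : 0 ≤ ∑ s ∈ Finset.range (Q + 1),
      4 * ((3 / 8) ^ s * if u ≤ 2 ^ s then (1 : ℝ) else 0) :=
    Finset.sum_nonneg fun s _ => by split_ifs <;> positivity
  rcases lt_or_ge u (1 / 2) with hlt | hge
  · classical
    have hex : ∃ s, (1 / 2 : ℝ) ^ s ≤ u := ⟨S, hS⟩
    obtain ⟨k, hk⟩ : ∃ k, Nat.find hex = k + 2 := by
      have h0 : Nat.find hex ≠ 0 := fun h => by
        have := Nat.find_spec hex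
        rw [h] at this
        norm_num at this
        linarith
      have h0' : Nat.find hex ≠ 1 := fun h => by
        have := Nat.find_spec hex
        rw [h] at this
        norm_num at this
        linarith
      exact ⟨Nat.find hex - 2, by omega⟩
    have hspec : (1 / 2 : ℝ) ^ (k + 2) ≤ u := hk ▸ Nat.find_spec hex
    have hmin : u ≤ (1 / 2 : ℝ) ^ (k + 1) :=
      (not_le.1 (Nat.find_min hex (m := k + 1) (by omega))).le
    have hkS : k + 2 ≤ S := hk ▸ Nat.find_le hS
    have hterm := Finset.single_le_sum
      (f := fun s => 2 * (2 ^ s * if u ≤ (1 / 2) ^ s then (1 : ℝ) else 0))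
      (s := Finset.Icc 1 S) (fun s _ => by split_ifs <;> positivity)
      (Finset.mem_Icc.2 ⟨by omega, by omega⟩ : k + 1 ∈ Finset.Icc 1 S)
    simp only [if_pos hmin, mul_one] at hterm
    have : decay u ≤ 2 * 2 ^ (k + 1) := by
      refine (min_le_left _ _).trans ?_
      rw [div_le_iff₀ hu]
      calc (1 : ℝ) = 2 * 2 ^ (k + 1) * (1 / 2) ^ (k + 2) := by
            rw [one_div, inv_pow]
            field_simp
            ring
        _ ≤ _ := by gcongr
    linarith
  · classical
    have hex : ∃ s, u ≤ 2 ^ s := ⟨Q, hQ⟩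
    have hspec := Nat.find_spec hex
    have hsQ : Nat.find hex ≤ Q := Nat.find_le hQ
    have hterm := Finset.single_le_sum
      (f := fun s => 4 * ((3 / 8) ^ s * if u ≤ 2 ^ s then (1 : ℝ) else 0))
      (s := Finset.range (Q + 1)) (fun s _ => by split_ifs <;> positivity)
      (Finset.mem_range.2 (by omega) : Nat.find hex ∈ Finset.range (Q + 1))
    simp only [if_pos hspec, mul_one] at hterm
    suffices decay u ≤ 4 * (3 / 8) ^ Nat.find hex by linarith
    rcases Nat.eq_zero_or_eq_succ_pred (Nat.find hex) with h0 | h0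
    · rw [h0]
      refine (min_le_left _ _).trans ?_
      rw [div_le_iff₀ hu]
      linarith
    · set k := (Nat.find hex).pred
      have hmin : 2 ^ k ≤ u := (not_le.1 (Nat.find_min hex (m := k) (by omega))).le
      rw [h0, Nat.succ_eq_add_one, pow_succ]
      have hsq : (4 / 3 : ℝ) ^ k ≤ √u := by
        refine Real.le_sqrt_of_sq_le (le_trans ?_ hmin)
        rw [← pow_mul, mul_comm, pow_mul]
        exact pow_le_pow_left₀ (by norm_num) (by norm_num) _
      refine (min_le_right _ _).trans ?_
      rw [div_le_iff₀ (by positivity)]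
      calc (1 : ℝ) ≤ 4 * (3 / 8) * ((3 / 8) ^ k * (2 ^ k * (4 / 3) ^ k)) := by
            rw [← mul_pow, ← mul_pow]
            norm_num
        _ ≤ 4 * (3 / 8) * ((3 / 8) ^ k * (u * √u)) := by gcongr
        _ = _ := by ring

theorem sum_inv_abs_le (m : ℕ) :
    ∑ k ∈ (Finset.Icc (-(m : ℤ)) m).erase 0, 1 / |(k : ℝ)| ≤ 2 * (1 + log m) := by
  have h : ∑ i ∈ Finset.Icc 1 m, 1 / |((i : ℤ) : ℝ)| ≤ 1 + log m := by
    refine le_trans (le_of_eq ?_) (harmonic_le_one_add_log m)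
    rw [harmonic_eq_sum_Icc]
    push_cast
    refine Finset.sum_congr rfl fun i _ => ?_
    rw [one_div, Nat.abs_cast]
  rw [sum_Icc_erase_zero]
  simp only [Int.cast_neg, abs_neg]
  linarith

theorem sum_inv_sq_le (A H : ℕ) (hA : 1 ≤ A) :
    ∑ g ∈ (Finset.Icc (-(H : ℤ)) H).filter (fun g => (A : ℤ) < |g|), 1 / (g : ℝ) ^ 2 ≤ 2 / (A : ℝ) := by
  have h : ∑ i ∈ Finset.Icc 1 H, (if A < i then 1 / (i : ℝ) ^ 2 else 0) ≤ 1 / (A : ℝ) := by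
    rw [← Finset.sum_filter]
    rcases le_total A H with hAH | hAH
    · calc _ = ∑ i ∈ Finset.Ioc A H, ((i : ℝ) ^ 2)⁻¹ := by
            refine Finset.sum_congr ?_ fun i _ => one_div _
            ext i
            simp only [Finset.mem_filter, Finset.mem_Icc, Finset.mem_Ioc]
            omega
        _ ≤ (A : ℝ)⁻¹ - (H : ℝ)⁻¹ := sum_Ioc_inv_sq_le_sub (by omega) hAH
        _ ≤ 1 / A := by
            rw [one_div]
            have : (0 : ℝ) ≤ (H : ℝ)⁻¹ := by positivity
            linarith
    · rw [Finset.filter_false_of_mem]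
      · simp
      · intro i hi
        have := (Finset.mem_Icc.1 hi).2
        omega
  have hset : (Finset.Icc (-(H : ℤ)) H).filter (fun g => (A : ℤ) < |g|) =
      ((Finset.Icc (-(H : ℤ)) H).erase 0).filter (fun g => (A : ℤ) < |g|) := by
    ext g
    simp only [Finset.mem_filter, Finset.mem_erase]
    refine ⟨fun h => ⟨⟨?_, h.1⟩, h.2⟩, fun h => ⟨h.1.2, h.2⟩⟩
    rintro rfl
    have := h.2
    rw [abs_zero] at this
    omega
  rw [hset, Finset.sum_filter, sum_Icc_erase_zero]
  simp only [Int.cast_neg, abs_neg, even_two, Even.neg_pow, Int.cast_natCast, Nat.abs_cast,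
    Nat.cast_lt]
  have : (2 : ℝ) / A = 1 / A + 1 / A := by ring
  linarith

theorem sum_inv_height_le (d H : ℕ) :
    ∑ h ∈ (box d H).erase 0, 1 / height h ≤ (3 + 2 * log H) ^ d := by
  have h1 : ∑ h ∈ (box d H).erase 0, 1 / height h ≤ ∑ h ∈ box d H, 1 / height h :=
    Finset.sum_le_sum_of_subset_of_nonneg (Finset.erase_subset _ _) fun h _ _ =>
      (one_div_pos.2 (height_pos h)).le
  have h2 : ∑ h ∈ box d H, 1 / height h
      = ∏ _i : Fin d, ∑ k ∈ Finset.Icc (-(H : ℤ)) H, 1 / rad k := by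
    rw [Finset.prod_univ_sum, box]
    refine Finset.sum_congr rfl fun h _ => ?_
    rw [height, one_div, ← Finset.prod_inv_distrib]
    simp only [one_div]
  have h3 : ∑ k ∈ Finset.Icc (-(H : ℤ)) H, 1 / rad k ≤ 3 + 2 * log H := by
    have hz : (0 : ℤ) ∈ Finset.Icc (-(H : ℤ)) H := by simp
    rw [← Finset.add_sum_erase _ _ hz]
    have : ∑ k ∈ (Finset.Icc (-(H : ℤ)) H).erase 0, 1 / rad k
        = ∑ k ∈ (Finset.Icc (-(H : ℤ)) H).erase 0, 1 / |(k : ℝ)| :=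
      Finset.sum_congr rfl fun k hk => by rw [rad_of_ne (Finset.ne_of_mem_erase hk)]
    have h4 := sum_inv_abs_le H
    have h5 : 1 / rad 0 = 1 := by simp [rad]
    linarith
  refine h1.trans (h2.trans_le ?_)
  rw [Finset.prod_const, Finset.card_univ, Fintype.card_fin]
  exact pow_le_pow_left₀ (Finset.sum_nonneg fun k _ => (one_div_pos.2 (rad_pos k)).le) h3 _

theorem height_smul_ge {d : ℕ} {g : ℤ} (hg : g ≠ 0) {w : Fin d → ℤ} (hw : w ≠ 0) :
    |(g : ℝ)| * height w ≤ height (g • w) := by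
  have hg1 : (1 : ℝ) ≤ |(g : ℝ)| := by exact_mod_cast Int.one_le_abs hg
  obtain ⟨i, hi⟩ := Function.ne_iff.1 hw
  rw [height, height, ← Finset.mul_prod_erase _ _ (Finset.mem_univ i),
    ← Finset.mul_prod_erase _ _ (Finset.mem_univ i), ← mul_assoc]
  have hrad : ∀ k, rad k ≤ rad (g * k) := fun k => by
    refine max_le_max le_rfl ?_
    rw [Int.cast_mul, abs_mul]
    exact le_mul_of_one_le_left (abs_nonneg _) hg1
  have h0 : |(g : ℝ)| * rad (w i) = rad (g * w i) := by
    rw [rad_of_ne hi, rad_of_ne (mul_ne_zero hg hi), Int.cast_mul, abs_mul]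
  have hnn : ∀ k ∈ Finset.univ.erase i, 0 ≤ rad (w k) := fun k _ => (rad_pos _).le
  simp only [Pi.smul_apply, smul_eq_mul]
  rw [h0]
  exact mul_le_mul_of_nonneg_left (Finset.prod_le_prod hnn fun k _ => hrad _) (rad_pos _).le

theorem height_le_of_mem_box {d H : ℕ} (hH : 1 ≤ H) {h : Fin d → ℤ} (hh : h ∈ box d H) :
    height h ≤ (H : ℝ) ^ d := by
  have : ∀ i ∈ Finset.univ, rad (h i) ≤ (H : ℝ) := fun i _ => by
    refine max_le (by exact_mod_cast hH) ?_
    exact_mod_cast mem_box.1 hh i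
  refine (Finset.prod_le_prod (fun i _ => (rad_pos _).le) this).trans ?_
  simp

theorem measurePreserving_zsmul {q : ℤ} (hq : q ≠ 0) :
    MeasurePreserving (fun θ : UnitAddCircle => q • θ) volume volume := by
  have hsurj : Function.Surjective (zsmulAddGroupHom q : UnitAddCircle →+ UnitAddCircle) := by
    intro y
    obtain ⟨x, rfl⟩ := QuotientAddGroup.mk_surjective y
    refine ⟨((x / q : ℝ) : UnitAddCircle), ?_⟩
    have hq' : (q : ℝ) ≠ 0 := by exact_mod_cast hq
    change q • ((x / q : ℝ) : UnitAddCircle) = (x : UnitAddCircle)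
    rw [← AddCircle.coe_zsmul, zsmul_eq_mul, mul_div_cancel₀ _ hq']
  exact AddMonoidHom.measurePreserving (f := (zsmulAddGroupHom q : UnitAddCircle →+ UnitAddCircle))
    (continuous_zsmul q) hsurj rfl

theorem measure_forall_zsmul_le {d : ℕ} {q : ℤ} (hq : q ≠ 0) {δ : Fin d → ℝ} (hδ : ∀ i, 0 ≤ δ i) :
    volume.real {x : Fin d → UnitAddCircle | ∀ i, ‖q • x i‖ ≤ δ i} ≤ ∏ i, 2 * δ i := by
  have hset : {x : Fin d → UnitAddCircle | ∀ i, ‖q • x i‖ ≤ δ i}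
      = Set.univ.pi fun i => (fun θ : UnitAddCircle => q • θ) ⁻¹' Metric.closedBall 0 (δ i) := by
    ext x
    simp
  rw [hset, Measure.real, volume_pi_pi, ENNReal.toReal_prod]
  refine Finset.prod_le_prod (fun i _ => ENNReal.toReal_nonneg) fun i _ => ?_
  have := (measurePreserving_zsmul hq).measureReal_preimage (s := Metric.closedBall 0 (δ i))
    Metric.isClosed_closedBall.measurableSet.nullMeasurableSet
  exact this.trans_le (volume_real_closedBall_le 0 (hδ i))

theorem measurableSet_forall_zsmul_le {d : ℕ} (q : ℤ) (δ : Fin d → ℝ) :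
    MeasurableSet {x : Fin d → UnitAddCircle | ∀ i, ‖q • x i‖ ≤ δ i} := by
  have : {x : Fin d → UnitAddCircle | ∀ i, ‖q • x i‖ ≤ δ i}
      = ⋂ i, {x : Fin d → UnitAddCircle | ‖q • x i‖ ≤ δ i} := by
    ext x
    simp
  rw [this]
  refine MeasurableSet.iInter fun i => (isClosed_le ?_ continuous_const).measurableSet
  exact ((continuous_zsmul q).comp (continuous_apply i)).norm

theorem closeCount_eq_sum {d : ℕ} (x : Fin d → UnitAddCircle) (M : ℕ) (l : Fin d → ℕ) :
    (closeCount x M l : ℝ) = ∑ q ∈ Finset.Ioo (-(M : ℤ)) M,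
      {x : Fin d → UnitAddCircle | ∀ i, ‖q • x i‖ ≤ 2 * (1 / 2) ^ l i}.indicator 1 x := by
  rw [closeCount, Finset.card_filter]
  push_cast
  refine Finset.sum_congr rfl fun q _ => ?_
  simp only [Set.indicator_apply, Set.mem_ofPred_eq, Pi.one_apply]

theorem integrable_closeCount {d : ℕ} (M : ℕ) (l : Fin d → ℕ) :
    Integrable (fun x : Fin d → UnitAddCircle => (closeCount x M l : ℝ)) := by
  simp only [closeCount_eq_sum]
  exact integrable_finsetSum _ fun q _ =>
    (integrable_const (1 : ℝ)).indicator (measurableSet_forall_zsmul_le q _)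

theorem integral_closeCount_le {d M : ℕ} {l : Fin d → ℕ} (hM : M ≤ 2 ^ ∑ i, l i) :
    ∫ x : Fin d → UnitAddCircle, (closeCount x M l : ℝ) ≤ 1 + 2 * 4 ^ d := by
  simp only [closeCount_eq_sum]
  have h_intble : ∀ q ∈ Finset.Ioo (-(M : ℤ)) M, Integrable (fun x => {x : Fin d → UnitAddCircle |
      ∀ i, ‖q • x i‖ ≤ 2 * (1 / 2) ^ l i}.indicator (1 : (Fin d → UnitAddCircle) → ℝ) x) :=
    fun q _ => (integrable_const (1 : ℝ)).indicator (measurableSet_forall_zsmul_le q _)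
  rw [integral_finsetSum _ h_intble]
  simp only [integral_indicator_one (measurableSet_forall_zsmul_le _ _)]
  have hprod : ∏ i, 2 * (2 * (1 / 2 : ℝ) ^ l i) = 4 ^ d * (1 / 2) ^ ∑ i, l i := by
    rw [Finset.prod_mul_distrib, Finset.prod_mul_distrib, Finset.prod_pow_eq_pow_sum]
    simp only [Finset.prod_const, Finset.card_univ, Fintype.card_fin]
    rw [← mul_assoc, ← mul_pow]
    norm_num
  have hM' : (M : ℝ) * (1 / 2) ^ ∑ i, l i ≤ 1 := by
    have : (M : ℝ) ≤ 2 ^ ∑ i, l i := by exact_mod_cast hM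
    calc _ ≤ (2 : ℝ) ^ (∑ i, l i) * (1 / 2) ^ ∑ i, l i := by gcongr
      _ = 1 := by rw [← mul_pow]; norm_num
  rcases Nat.eq_zero_or_pos M with rfl | hpos
  · simp
    positivity
  have hz : (0 : ℤ) ∈ Finset.Ioo (-(M : ℤ)) M := by simp [hpos]
  rw [← Finset.add_sum_erase _ _ hz]
  have hcard : (((Finset.Ioo (-(M : ℤ)) M).erase 0).card : ℝ) ≤ 2 * M := by
    have := Finset.card_le_card (Finset.erase_subset 0 (Finset.Ioo (-(M : ℤ)) M))
    rw [Int.card_Ioo] at this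
    have h2 : ((Finset.Ioo (-(M : ℤ)) M).erase 0).card ≤ 2 * M := by omega
    exact_mod_cast h2
  have hrest : ∑ q ∈ (Finset.Ioo (-(M : ℤ)) M).erase 0,
      volume.real {x : Fin d → UnitAddCircle | ∀ i, ‖q • x i‖ ≤ 2 * (1 / 2) ^ l i}
      ≤ 2 * M * (4 ^ d * (1 / 2) ^ ∑ i, l i) := by
    refine (Finset.sum_le_card_nsmul _ _ (4 ^ d * (1 / 2 : ℝ) ^ ∑ i, l i) fun q hq => ?_).trans ?_
    · rw [← hprod]
      exact measure_forall_zsmul_le (Finset.ne_of_mem_erase hq) fun i => by positivity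
    · rw [nsmul_eq_mul]
      gcongr
  have h1 := measureReal_le_one (μ := (volume : Measure (Fin d → UnitAddCircle)))
    (s := {x | ∀ i, ‖(0 : ℤ) • x i‖ ≤ 2 * (1 / 2 : ℝ) ^ l i})
  have h4 : (0 : ℝ) < 4 ^ d := by positivity
  nlinarith [mul_le_mul_of_nonneg_left hM' h4.le]

/-- The sum of the inverse heights of the nonzero frequencies in a box. -/
noncomputable def heightSum (d H : ℕ) : ℝ := ∑ h ∈ (box d H).erase 0, 1 / height h

theorem heightSum_nonneg (d H : ℕ) : 0 ≤ heightSum d H :=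
  Finset.sum_nonneg fun h _ => (one_div_pos.2 (height_pos h)).le

theorem width_smul_div_le {d : ℕ} {a : ℤ} (ha : a ≠ 0) {w : Fin d → ℤ} (hw : w ≠ 0) (s : ℕ) :
    width (a • w) s / |(a : ℝ)| ≤ (1 / 2) ^ s * (1 / (a : ℝ) ^ 2 * (1 / height w)) := by
  have ha' : 0 < |(a : ℝ)| := abs_pos.2 (by exact_mod_cast ha)
  have hw' := height_pos w
  rw [width, ← sq_abs (a : ℝ)]
  calc _ ≤ (1 / 2 : ℝ) ^ s / (|(a : ℝ)| * height w) / |(a : ℝ)| := by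
        gcongr
        exact height_smul_ge ha hw
    _ = _ := by field_simp

theorem sum_ite_eq_le {ι : Type*} [DecidableEq ι] (B : Finset ι) (a : ι) (f : ι → ℝ)
    (hf : 0 ≤ f a) : ∑ h ∈ B, (if h = a then f h else 0) ≤ f a := by
  rw [Finset.sum_ite_eq']
  split_ifs
  · exact le_rfl
  · exact hf

theorem sum_measure_imprimitive_le (d H : ℕ) {A : ℕ} (hA : 1 ≤ A) (s : ℕ) :
    ∑ h ∈ (box d H).erase 0, 2 ^ s * volume.real (imprimitive A H h s : Set (Fin d → UnitAddCircle))
      ≤ 4 * heightSum d H / A := by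
  classical
  have h1 : ∀ h : Fin d → ℤ, volume.real (imprimitive A H h s) ≤
      ∑ p ∈ Finset.Icc (-(H : ℤ)) H ×ˢ (box d H).erase 0,
        if h = p.1 • p.2 then (if (A : ℤ) < |p.1| then 2 * (width h s / |(p.1 : ℝ)|) else 0)
          else 0 := by
    intro h
    refine (measureReal_biUnion_finset_le _ _).trans ?_
    rw [Finset.sum_filter]
    refine Finset.sum_le_sum fun p hp => ?_
    have hp2 : p.2 ≠ 0 := Finset.ne_of_mem_erase (Finset.mem_product.1 hp).2
    have hw := (width_pos h s).le
    by_cases hA' : (A : ℤ) < |p.1| <;> by_cases heq : h = p.1 • p.2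
    · simp only [hA', heq, and_self, if_true]
      exact measure_lin_le hp2 (div_nonneg (width_pos _ s).le (abs_nonneg _))
    · rw [if_neg fun hc => heq hc.2, if_neg heq]
    · simp [hA']
    · rw [if_neg fun hc => heq hc.2, if_neg heq]
  rw [← Finset.mul_sum]
  calc _ ≤ 2 ^ s * ∑ h ∈ (box d H).erase 0, ∑ p ∈ Finset.Icc (-(H : ℤ)) H ×ˢ (box d H).erase 0,
        (if h = p.1 • p.2 then (if (A : ℤ) < |p.1| then 2 * (width h s / |(p.1 : ℝ)|) else 0)
          else 0) := by
        gcongr with h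
        exact h1 h
    _ ≤ 2 ^ s * ∑ p ∈ Finset.Icc (-(H : ℤ)) H ×ˢ (box d H).erase 0,
        (if (A : ℤ) < |p.1| then 2 * ((1 / 2) ^ s * (1 / (p.1 : ℝ) ^ 2 * (1 / height p.2)))
          else 0) := by
        rw [Finset.sum_comm]
        gcongr with p hp
        have hp2 : p.2 ≠ 0 := Finset.ne_of_mem_erase (Finset.mem_product.1 hp).2
        have hw := (width_pos (p.1 • p.2) s).le
        refine (sum_ite_eq_le _ (p.1 • p.2)
          (fun h => if (A : ℤ) < |p.1| then 2 * (width h s / |(p.1 : ℝ)|) else 0) ?_).trans ?_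
        · split_ifs <;> positivity
        · split_ifs with hA'
          · have ha : p.1 ≠ 0 := fun h0 => by
              rw [h0, abs_zero] at hA'
              omega
            exact mul_le_mul_of_nonneg_left (width_smul_div_le ha hp2 s) (by norm_num)
          · exact le_rfl
    _ = 2 * ((∑ g ∈ (Finset.Icc (-(H : ℤ)) H).filter (fun g => (A : ℤ) < |g|), 1 / (g : ℝ) ^ 2)
          * heightSum d H) := by
        rw [heightSum, Finset.sum_filter, Finset.sum_mul_sum, ← Finset.sum_product', Finset.mul_sum,
          Finset.mul_sum]
        refine Finset.sum_congr rfl fun p _ => ?_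
        split_ifs
        · have : (2 : ℝ) ^ s * (1 / 2) ^ s = 1 := by rw [← mul_pow]; norm_num
          linear_combination (2 * (1 / (p.1 : ℝ) ^ 2 * (1 / height p.2))) * this
        · ring
    _ ≤ 2 * (2 / A * heightSum d H) := by
        have := heightSum_nonneg d H
        gcongr
        exact sum_inv_sq_le A H hA
    _ = _ := by ring

theorem min_sq_le_mul {x y : ℝ} (hx : 0 ≤ x) (hy : 0 ≤ y) : min (x ^ 2) (y ^ 2) ≤ x * y := by
  rcases le_total x y with h | h
  · exact (min_le_left _ _).trans (by nlinarith)
  · exact (min_le_right _ _).trans (by nlinarith)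

theorem sum_parallelTerm_le (d A H : ℕ) (s s' : ℕ) :
    ∑ h ∈ (box d H).erase 0, ∑ h' ∈ (box d H).erase 0,
      2 ^ s * 2 ^ s' * parallelTerm A H h h' s s'
      ≤ 8 * (1 + log A) ^ 2 * heightSum d H * (√2 ^ s * √2 ^ s') := by
  classical
  set B := (box d H).erase 0
  set P := (Finset.Icc (-(A : ℤ)) A).erase 0
  have hr : ∀ s : ℕ, (1 / 2 : ℝ) ^ s = ((√2)⁻¹ ^ s) ^ 2 := fun s => by
    rw [← pow_mul, mul_comm, pow_mul, inv_pow, sq_sqrt zero_le_two, one_div]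
  have hs2 : ∀ s : ℕ, (2 : ℝ) ^ s * (√2)⁻¹ ^ s = √2 ^ s := fun s => by
    rw [← mul_pow, ← div_eq_mul_inv, div_sqrt]
  have hmin : ∀ p ∈ P ×ˢ P ×ˢ B, min (width (p.1 • p.2.2) s / |(p.1 : ℝ)|)
      (width (p.2.1 • p.2.2) s' / |(p.2.1 : ℝ)|) ≤
      (√2)⁻¹ ^ s * (√2)⁻¹ ^ s' * (1 / |(p.1 : ℝ)| * (1 / |(p.2.1 : ℝ)| * (1 / height p.2.2))) := by
    intro p hp
    simp only [P, B, Finset.mem_product, Finset.mem_erase] at hp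
    obtain ⟨⟨ha, -⟩, ⟨hb, -⟩, hw, -⟩ := hp
    have hh := height_pos p.2.2
    refine (min_le_min (width_smul_div_le ha hw s) (width_smul_div_le hb hw s')).trans ?_
    have e : ∀ (a : ℤ) (s : ℕ), (1 / 2 : ℝ) ^ s * (1 / (a : ℝ) ^ 2 * (1 / height p.2.2))
        = ((√2)⁻¹ ^ s * (1 / |(a : ℝ)|)) ^ 2 * (1 / height p.2.2) := fun a s => by
      rw [hr, mul_pow, div_pow, sq_abs, one_pow]
      ring
    rw [e, e, ← min_mul_of_nonneg _ _ (one_div_pos.2 hh).le]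
    refine (mul_le_mul_of_nonneg_right (min_sq_le_mul (by positivity) (by positivity))
      (one_div_pos.2 hh).le).trans (le_of_eq (by ring))
  have hterm : ∀ p ∈ P ×ˢ P ×ˢ B, ∑ h ∈ B, ∑ h' ∈ B,
      (if h = p.1 • p.2.2 ∧ h' = p.2.1 • p.2.2 then
        2 * min (width h s / |(p.1 : ℝ)|) (width h' s' / |(p.2.1 : ℝ)|) else 0) ≤
      2 * ((√2)⁻¹ ^ s * (√2)⁻¹ ^ s' *
        (1 / |(p.1 : ℝ)| * (1 / |(p.2.1 : ℝ)| * (1 / height p.2.2)))) := by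
    intro p hp
    have hwa := (width_pos (p.1 • p.2.2) s).le
    have hwb := (width_pos (p.2.1 • p.2.2) s').le
    refine le_trans ?_ (mul_le_mul_of_nonneg_left (hmin p hp) zero_le_two)
    simp only [ite_and]
    have hin : ∀ h ∈ B, (∑ h' ∈ B, if h = p.1 • p.2.2 then
        (if h' = p.2.1 • p.2.2 then 2 * min (width h s / |(p.1 : ℝ)|) (width h' s' / |(p.2.1 : ℝ)|)
          else 0) else 0) ≤ if h = p.1 • p.2.2 then
            2 * min (width h s / |(p.1 : ℝ)|) (width (p.2.1 • p.2.2) s' / |(p.2.1 : ℝ)|)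
            else 0 := by
      intro h _
      split_ifs with hh
      · have := (width_pos h s).le
        exact sum_ite_eq_le B (p.2.1 • p.2.2)
          (fun h' => 2 * min (width h s / |(p.1 : ℝ)|) (width h' s' / |(p.2.1 : ℝ)|))
          (by positivity)
      · simp
    refine (Finset.sum_le_sum hin).trans ?_
    exact sum_ite_eq_le B (p.1 • p.2.2)
      (fun h => 2 * min (width h s / |(p.1 : ℝ)|) (width (p.2.1 • p.2.2) s' / |(p.2.1 : ℝ)|))
      (by positivity)
  have hlog : 0 ≤ ∑ k ∈ P, 1 / |(k : ℝ)| := Finset.sum_nonneg fun k _ => by positivity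
  have hHS := heightSum_nonneg d H
  calc _ = 2 ^ s * 2 ^ s' * ∑ p ∈ P ×ˢ P ×ˢ B, ∑ h ∈ B, ∑ h' ∈ B,
      (if h = p.1 • p.2.2 ∧ h' = p.2.1 • p.2.2 then
        2 * min (width h s / |(p.1 : ℝ)|) (width h' s' / |(p.2.1 : ℝ)|) else 0) := by
        simp only [← Finset.mul_sum, parallelTerm]
        rw [Finset.sum_comm]
        congr 1
        rw [Finset.sum_comm, Finset.sum_congr rfl fun h _ => Finset.sum_comm, Finset.sum_comm]
    _ ≤ 2 ^ s * 2 ^ s' * ∑ p ∈ P ×ˢ P ×ˢ B, 2 * ((√2)⁻¹ ^ s * (√2)⁻¹ ^ s' *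
        (1 / |(p.1 : ℝ)| * (1 / |(p.2.1 : ℝ)| * (1 / height p.2.2)))) := by
        gcongr with p hp
        exact hterm p hp
    _ = 2 * (√2 ^ s * √2 ^ s') * ((∑ k ∈ P, 1 / |(k : ℝ)|) * ((∑ k ∈ P, 1 / |(k : ℝ)|)
          * heightSum d H)) := by
        rw [← hs2, ← hs2, heightSum, Finset.sum_mul_sum, ← Finset.sum_product',
          Finset.sum_mul_sum, ← Finset.sum_product', Finset.mul_sum, Finset.mul_sum]
        refine Finset.sum_congr rfl fun p _ => ?_
        ring
    _ ≤ 2 * (√2 ^ s * √2 ^ s') * ((2 * (1 + log A)) * ((2 * (1 + log A)) * heightSum d H)) := by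
        have := sum_inv_abs_le A
        have h2 : 0 ≤ 2 * (1 + log A) := hlog.trans this
        gcongr
    _ = _ := by ring

theorem sum_sqrt_two_pow_le (S : ℕ) : ∑ s ∈ Finset.Icc 1 S, √2 ^ s ≤ 4 * √2 ^ S := by
  have h2 : (4 / 3 : ℝ) ≤ √2 := Real.le_sqrt_of_sq_le (by norm_num)
  induction S with
  | zero => simp
  | succ S ih =>
    rw [Finset.sum_Icc_succ_top (by omega), pow_succ]
    have : 0 < √2 ^ S := by positivity
    nlinarith

theorem measure_strip {d : ℕ} {h : Fin d → ℤ} (hh : h ≠ 0) {s : ℕ} (hs : 1 ≤ s) :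
    volume.real (strip h s) = 2 * width h s := by
  rw [strip, measure_lin_le_eq hh, volume_real_closedBall (width_pos h s).le]
  rw [width, div_le_iff₀ (height_pos h)]
  have h1 : (1 / 2 : ℝ) ^ s ≤ 1 / 2 := pow_le_of_le_one (by norm_num) (by norm_num) (by omega)
  linarith [one_le_height h]

theorem sum_two_pow_mul_width (d H S : ℕ) :
    ∑ p ∈ (box d H).erase 0 ×ˢ Finset.Icc 1 S, 2 ^ p.2 * (2 * width p.1 p.2)
      = 2 * S * heightSum d H := by
  have h1 : ∀ p : (Fin d → ℤ) × ℕ, 2 ^ p.2 * (2 * width p.1 p.2) = 2 * (1 / height p.1) := by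
    intro p
    have : (2 : ℝ) ^ p.2 * (1 / 2) ^ p.2 = 1 := by rw [← mul_pow]; norm_num
    rw [width]
    linear_combination (2 / height p.1) * this
  simp only [h1]
  rw [Finset.sum_product]
  simp only [Finset.sum_const, Nat.card_Icc, add_tsub_cancel_right, nsmul_eq_mul, heightSum,
    Finset.mul_sum]
  exact Finset.sum_congr rfl fun h _ => by ring

theorem sum_imprimitive_le (d H S : ℕ) {A : ℕ} (hA : 1 ≤ A) :
    ∑ p ∈ (box d H).erase 0 ×ˢ Finset.Icc 1 S, 2 ^ p.2 *
      volume.real (imprimitive A H p.1 p.2 : Set (Fin d → UnitAddCircle))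
      ≤ 4 * S * heightSum d H / A := by
  rw [Finset.sum_product_right]
  refine (Finset.sum_le_card_nsmul _ _ (4 * heightSum d H / A) fun s _ =>
    sum_measure_imprimitive_le d H hA s).trans (le_of_eq ?_)
  rw [Nat.card_Icc, add_tsub_cancel_right, nsmul_eq_mul]
  ring

theorem sum_pair_le (d H S A : ℕ) :
    ∑ p ∈ (box d H).erase 0 ×ˢ Finset.Icc 1 S, ∑ q ∈ (box d H).erase 0 ×ˢ Finset.Icc 1 S,
      2 ^ p.2 * 2 ^ q.2 * volume.real ((strip p.1 p.2 \ imprimitive A H p.1 p.2) ∩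
        (strip q.1 q.2 \ imprimitive A H q.1 q.2))
      ≤ (2 * S * heightSum d H) ^ 2 + 128 * (1 + log A) ^ 2 * heightSum d H * 2 ^ S := by
  have hR := heightSum_nonneg d H
  calc _ ≤ ∑ p ∈ (box d H).erase 0 ×ˢ Finset.Icc 1 S, ∑ q ∈ (box d H).erase 0 ×ˢ Finset.Icc 1 S,
        (2 ^ p.2 * (2 * width p.1 p.2) * (2 ^ q.2 * (2 * width q.1 q.2)) +
          2 ^ p.2 * 2 ^ q.2 * parallelTerm A H p.1 q.1 p.2 q.2) := by
        refine Finset.sum_le_sum fun p hp => Finset.sum_le_sum fun q hq => ?_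
        have := measure_strip_pair_le (A := A) (Finset.mem_product.1 hp).1
          (Finset.mem_product.1 hq).1 p.2 q.2
        refine (mul_le_mul_of_nonneg_left this (by positivity)).trans (le_of_eq (by ring))
    _ = (2 * S * heightSum d H) ^ 2 + ∑ s ∈ Finset.Icc 1 S, ∑ s' ∈ Finset.Icc 1 S,
        ∑ h ∈ (box d H).erase 0, ∑ h' ∈ (box d H).erase 0,
          2 ^ s * 2 ^ s' * parallelTerm A H h h' s s' := by
        simp only [Finset.sum_add_distrib]
        rw [← Finset.sum_mul_sum, sum_two_pow_mul_width, ← sq]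
        congr 1
        rw [Finset.sum_product_right]
        refine Finset.sum_congr rfl fun s _ => ?_
        simp only [Finset.sum_product_right]
        rw [Finset.sum_comm]
    _ ≤ (2 * S * heightSum d H) ^ 2 + ∑ s ∈ Finset.Icc 1 S, ∑ s' ∈ Finset.Icc 1 S,
        8 * (1 + log A) ^ 2 * heightSum d H * (√2 ^ s * √2 ^ s') := by
        gcongr with s _ s' _
        exact sum_parallelTerm_le d A H s s'
    _ = (2 * S * heightSum d H) ^ 2 + 8 * (1 + log A) ^ 2 * heightSum d H *
        (∑ s ∈ Finset.Icc 1 S, √2 ^ s) ^ 2 := by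
        simp only [← Finset.mul_sum]
        rw [sq (∑ s ∈ Finset.Icc 1 S, √2 ^ s), Finset.sum_mul]
    _ ≤ (2 * S * heightSum d H) ^ 2 + 8 * (1 + log A) ^ 2 * heightSum d H * (4 * √2 ^ S) ^ 2 := by
        have : 0 ≤ ∑ s ∈ Finset.Icc 1 S, √2 ^ s := Finset.sum_nonneg fun s _ => by positivity
        gcongr
        exact sum_sqrt_two_pow_le S
    _ = _ := by
        have : (√2 ^ S) ^ 2 = 2 ^ S := by
          rw [← pow_mul, mul_comm, pow_mul, sq_sqrt zero_le_two]
        linear_combination (128 * (1 + log A) ^ 2 * heightSum d H) * this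

theorem measure_le_sum_indicator_le {Ω ι : Type*} [MeasurableSpace Ω] {μ : Measure Ω}
    [IsProbabilityMeasure μ] (I : Finset ι) {w : ι → ℝ} (hw : ∀ i ∈ I, 0 ≤ w i) {F : ι → Set Ω}
    (hF : ∀ i ∈ I, MeasurableSet (F i)) {E t : ℝ} (ht : 0 < t)
    (hE : ∑ i ∈ I, w i * μ.real (F i) ≤ E) :
    μ.real {x | t ≤ ∑ i ∈ I, w i * (F i).indicator 1 x} ≤ E / t := by
  have hI : ∀ i ∈ I, Integrable (fun x => w i * (F i).indicator (1 : Ω → ℝ) x) μ :=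
    fun i hi => ((integrable_const (1 : ℝ)).indicator (hF i hi)).const_mul _
  have hmk := mul_meas_ge_le_integral_of_nonneg (μ := μ)
    (f := fun x => ∑ i ∈ I, w i * (F i).indicator (1 : Ω → ℝ) x)
    (Filter.Eventually.of_forall fun x => Finset.sum_nonneg fun i hi =>
      mul_nonneg (hw i hi) (Set.indicator_nonneg (fun _ _ => zero_le_one) _))
    (integrable_finsetSum _ hI) t
  rw [le_div_iff₀ ht, mul_comm]
  refine hmk.trans (le_trans (le_of_eq ?_) hE)
  rw [integral_finsetSum _ hI]
  refine Finset.sum_congr rfl fun i hi => ?_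
  rw [integral_const_mul, integral_indicator_one (hF i hi)]

theorem measure_sum_strip_le (d H S : ℕ) {A : ℕ} (hA : 1 ≤ A) {t : ℝ} (ht : 0 < t) :
    volume.real {x : Fin d → UnitAddCircle | 2 * S * heightSum d H + 2 * t ≤
      ∑ p ∈ (box d H).erase 0 ×ˢ Finset.Icc 1 S, 2 ^ p.2 * (strip p.1 p.2).indicator 1 x} ≤
      (128 * (1 + log A) ^ 2 * heightSum d H * 2 ^ S + 16 * (S * heightSum d H) ^ 2 / A) / t ^ 2
        + 4 * S * heightSum d H / A / t := by
  set I := (box d H).erase 0 ×ˢ Finset.Icc 1 S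
  have hR := heightSum_nonneg d H
  have hmS : ∀ p ∈ I, MeasurableSet (strip p.1 p.2) := fun p _ => measurableSet_strip _ _
  have hmI : ∀ p ∈ I, MeasurableSet (imprimitive A H p.1 p.2) :=
    fun p _ => measurableSet_imprimitive _ _ _ _
  have h2 := measure_second_moment (μ := (volume : Measure (Fin d → UnitAddCircle))) I
    (fun p => (2 : ℝ) ^ p.2) (fun p => strip p.1 p.2 \ imprimitive A H p.1 p.2)
    (fun p hp => (hmS p hp).diff (hmI p hp)) (M := 2 * S * heightSum d H)
    (η := 4 * S * heightSum d H / A) (by positivity) ht ?_ (sum_pair_le d H S A)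
  · have h1 := measure_le_sum_indicator_le (μ := (volume : Measure (Fin d → UnitAddCircle))) I
      (w := fun p => (2 : ℝ) ^ p.2) (fun p _ => by positivity) hmI ht (sum_imprimitive_le d H S hA)
    refine (measureReal_mono (s₂ := {x | 2 * S * heightSum d H + t ≤ ∑ p ∈ I,
      (2 : ℝ) ^ p.2 * (strip p.1 p.2 \ imprimitive A H p.1 p.2).indicator 1 x} ∪
        {x | t ≤ ∑ p ∈ I, (2 : ℝ) ^ p.2 * (imprimitive A H p.1 p.2).indicator 1 x}) ?_
        (measure_ne_top _ _)).trans ((measureReal_union_le _ _).trans ?_)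
    · intro x hx
      rw [Set.mem_ofPred_eq] at hx
      by_contra hcon
      simp only [Set.mem_union, Set.mem_ofPred_eq, not_or, not_le] at hcon
      have : ∑ p ∈ I, (2 : ℝ) ^ p.2 * (strip p.1 p.2).indicator 1 x ≤
          ∑ p ∈ I, (2 : ℝ) ^ p.2 * (strip p.1 p.2 \ imprimitive A H p.1 p.2).indicator 1 x +
          ∑ p ∈ I, (2 : ℝ) ^ p.2 * (imprimitive A H p.1 p.2).indicator 1 x := by
        rw [← Finset.sum_add_distrib]
        refine Finset.sum_le_sum fun p _ => ?_
        rw [← mul_add]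
        gcongr
        by_cases ha : x ∈ strip p.1 p.2 <;> by_cases hb : x ∈ imprimitive A H p.1 p.2 <;>
          simp [ha, hb]
      linarith
    · refine add_le_add (h2.trans (le_of_eq ?_)) h1
      ring
  · have h3 : ∀ p ∈ I, (2 : ℝ) ^ p.2 * (2 * width p.1 p.2) ≤
        2 ^ p.2 * volume.real (strip p.1 p.2 \ imprimitive A H p.1 p.2) +
        2 ^ p.2 * volume.real (imprimitive A H p.1 p.2) := by
      intro p hp
      obtain ⟨hp1, hp2⟩ := Finset.mem_product.1 hp
      rw [← measure_strip (Finset.ne_of_mem_erase hp1) (Finset.mem_Icc.1 hp2).1, ← mul_add]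
      gcongr
      refine (measureReal_mono ?_ (measure_ne_top _ _)).trans (measureReal_union_le _ _)
      rw [Set.sdiff_union_self]
      exact Set.subset_union_left
    have h4 := Finset.sum_le_sum h3
    rw [Finset.sum_add_distrib, sum_two_pow_mul_width] at h4
    have h5 := sum_imprimitive_le d H S hA
    linarith

/-- Total number of close returns over all dyadic scales. -/
noncomputable def returnSum {d : ℕ} (n : ℕ) (x : Fin d → UnitAddCircle) : ℝ :=
  ∑ l ∈ Fintype.piFinset fun _ : Fin d => Finset.range (n + 1),
    (closeCount x (2 ^ min (∑ i, l i) n) l : ℝ)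

/-- Weighted number of resonances stronger than average. -/
noncomputable def strongSum {d : ℕ} (H S : ℕ) (x : Fin d → UnitAddCircle) : ℝ :=
  ∑ p ∈ (box d H).erase 0 ×ˢ Finset.Icc 1 S, 2 ^ p.2 * (strip p.1 p.2).indicator 1 x

/-- Weighted number of resonances weaker than average. -/
noncomputable def weakSum {d : ℕ} (H Q : ℕ) (x : Fin d → UnitAddCircle) : ℝ :=
  ∑ p ∈ (box d H).erase 0 ×ˢ Finset.range (Q + 1),
    (3 / 8) ^ p.2 * {x : Fin d → UnitAddCircle | ‖lin p.1 x‖ ≤ 2 ^ p.2 / height p.1}.indicator 1 x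

/-- The points at which one of the sums controlling the discrepancy is exceptionally large. -/
def exceptional (d n S : ℕ) (t : ℝ) : Set (Fin d → UnitAddCircle) :=
  (⋃ h ∈ (box d (4 ^ n)).erase 0, strip h S) ∪ {x | t ≤ returnSum n x} ∪
    {x | 2 * S * heightSum d (4 ^ n) + 2 * t ≤ strongSum (4 ^ n) S x} ∪
    {x | t ≤ weakSum (4 ^ n) (2 * n * d) x}

theorem measure_returnSum_le (d n : ℕ) {t : ℝ} (ht : 0 < t) :
    volume.real {x : Fin d → UnitAddCircle | t ≤ returnSum n x}
      ≤ (n + 1) ^ d * (1 + 2 * 4 ^ d) / t := by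
  have hI : ∀ l ∈ Fintype.piFinset fun _ : Fin d => Finset.range (n + 1), Integrable
      (fun x : Fin d → UnitAddCircle => (closeCount x (2 ^ min (∑ i, l i) n) l : ℝ)) :=
    fun l _ => integrable_closeCount _ l
  have hmk := mul_meas_ge_le_integral_of_nonneg (μ := (volume : Measure (Fin d → UnitAddCircle)))
    (f := fun x => returnSum n x)
    (Filter.Eventually.of_forall fun x => Finset.sum_nonneg fun l _ => Nat.cast_nonneg _)
    (integrable_finsetSum _ hI) t
  rw [le_div_iff₀ ht, mul_comm]
  refine hmk.trans ?_
  simp only [returnSum]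
  rw [integral_finsetSum _ hI]
  refine (Finset.sum_le_card_nsmul _ _ (1 + 2 * 4 ^ d) fun l _ =>
    integral_closeCount_le (Nat.pow_le_pow_right two_pos (min_le_left _ _))).trans (le_of_eq ?_)
  simp only [Fintype.card_piFinset, Finset.card_range, Finset.prod_const, Finset.card_univ,
    Fintype.card_fin, nsmul_eq_mul, Nat.cast_pow, Nat.cast_add, Nat.cast_one]

theorem measure_weakSum_le (d H Q : ℕ) {t : ℝ} (ht : 0 < t) :
    volume.real {x : Fin d → UnitAddCircle | t ≤ weakSum H Q x} ≤ 8 * heightSum d H / t := by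
  refine measure_le_sum_indicator_le (μ := (volume : Measure (Fin d → UnitAddCircle))) _
    (w := fun p : (Fin d → ℤ) × ℕ => (3 / 8 : ℝ) ^ p.2)
    (fun p _ => by positivity) (fun p _ => measurableSet_lin_le _ _) ht ?_
  have hterm : ∀ p ∈ (box d H).erase 0 ×ˢ Finset.range (Q + 1), (3 / 8 : ℝ) ^ p.2 *
      volume.real {x : Fin d → UnitAddCircle | ‖lin p.1 x‖ ≤ 2 ^ p.2 / height p.1} ≤
      2 * (1 / height p.1 * (3 / 4) ^ p.2) := by
    intro p hp
    have hh := height_pos p.1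
    have := measure_lin_le (Finset.ne_of_mem_erase (Finset.mem_product.1 hp).1)
      (δ := 2 ^ p.2 / height p.1) (by positivity)
    calc _ ≤ (3 / 8 : ℝ) ^ p.2 * (2 * (2 ^ p.2 / height p.1)) := by gcongr
      _ = 2 * (1 / height p.1 * ((3 / 8) ^ p.2 * 2 ^ p.2)) := by ring
      _ = _ := by
        rw [← mul_pow]
        norm_num
  refine (Finset.sum_le_sum hterm).trans ?_
  rw [← Finset.mul_sum, Finset.sum_product]
  dsimp only
  rw [← Finset.sum_mul_sum, ← heightSum]
  have := mul_le_mul_of_nonneg_left (sum_pow_three_quarters_le (Finset.range (Q + 1)))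
    (heightSum_nonneg d H)
  linarith

theorem measure_exceptional_le (d n S : ℕ) {A : ℕ} (hA : 1 ≤ A) {t : ℝ} (ht : 0 < t) :
    volume.real (exceptional d n S t) ≤ 2 * heightSum d (4 ^ n) / 2 ^ S +
      ((n + 1) ^ d * (1 + 2 * 4 ^ d) + 8 * heightSum d (4 ^ n) +
        4 * S * heightSum d (4 ^ n) / A) / t +
      (128 * (1 + log A) ^ 2 * heightSum d (4 ^ n) * 2 ^ S +
        16 * (S * heightSum d (4 ^ n)) ^ 2 / A) / t ^ 2 := by
  have h0 : volume.real (⋃ h ∈ (box d (4 ^ n)).erase 0, strip h S) ≤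
      2 * heightSum d (4 ^ n) / 2 ^ S := by
    refine (measureReal_biUnion_finset_le _ _).trans ((Finset.sum_le_sum fun h hh =>
      measure_lin_le (Finset.ne_of_mem_erase hh) (width_pos h S).le).trans (le_of_eq ?_))
    rw [heightSum, Finset.mul_sum, Finset.sum_div]
    refine Finset.sum_congr rfl fun h _ => ?_
    rw [width, one_div, inv_pow]
    ring
  refine (measureReal_union_le _ _).trans ((add_le_add ((measureReal_union_le _ _).trans
    (add_le_add ((measureReal_union_le _ _).trans (add_le_add h0 (measure_returnSum_le d n ht)))
      (measure_sum_strip_le d (4 ^ n) S hA ht))) (measure_weakSum_le d (4 ^ n) _ ht)).trans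
      (le_of_eq ?_))
  ring

theorem decay_sum_le {d n S : ℕ} {x : Fin d → UnitAddCircle}
    (hx : ∀ h ∈ (box d (4 ^ n)).erase 0, width h S < ‖lin h x‖) :
    ∑ h ∈ (box d (4 ^ n)).erase 0, decay (height h * ‖lin h x‖) ≤
      2 * strongSum (4 ^ n) S x + 4 * weakSum (4 ^ n) (2 * n * d) x := by
  rw [strongSum, weakSum, Finset.sum_product, Finset.sum_product, Finset.mul_sum, Finset.mul_sum,
    ← Finset.sum_add_distrib]
  refine Finset.sum_le_sum fun h hh => ?_
  have hpos := height_pos h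
  have h1 := hx h hh
  rw [width, div_lt_iff₀ hpos, mul_comm] at h1
  have h2 : height h * ‖lin h x‖ ≤ 2 ^ (2 * n * d) := by
    have h3 := height_le_of_mem_box (Nat.one_le_pow _ _ (by norm_num)) (Finset.mem_of_mem_erase hh)
    have h4 : ‖lin h x‖ ≤ 1 := (AddCircle.norm_le_half_period 1 one_ne_zero).trans (by norm_num)
    have h5 : (((4 ^ n : ℕ) : ℝ)) ^ d = 2 ^ (2 * n * d) := by
      push_cast
      rw [show (4 : ℝ) = 2 ^ 2 by norm_num, ← pow_mul, ← pow_mul, mul_assoc]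
    rw [h5] at h3
    exact (mul_le_of_le_one_right hpos.le h4).trans h3
  refine (decay_le_dyadic h1.le h2).trans (le_of_eq ?_)
  rw [Finset.mul_sum, Finset.mul_sum]
  congr 1
  · refine Finset.sum_congr rfl fun s _ => ?_
    simp only [Set.indicator_apply, strip, width, Set.mem_ofPred_eq, le_div_iff₀ hpos,
      mul_comm (height h), Pi.one_apply]
  · refine Finset.sum_congr rfl fun s _ => ?_
    simp only [Set.indicator_apply, Set.mem_ofPred_eq, le_div_iff₀ hpos,
      mul_comm (height h), Pi.one_apply]

/-- Discrepancy constant multiplying the threshold of the exceptional set. -/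
noncomputable def thresholdConst (d : ℕ) : ℝ := 2 * 6 ^ d + 2 * d * 4 ^ d + 8 * 17 ^ d

theorem abs_card_sub_le_of_notMem_exceptional {d n S : ℕ} (hn : 1 ≤ n) {t : ℝ} {α : Fin d → ℝ}
    (hα : (fun i => (α i : UnitAddCircle)) ∉ exceptional d n S t) {u v : Fin d → ℝ}
    (hb : ∀ i, 0 ≤ u i ∧ u i ≤ v i ∧ v i ≤ 1) {N : ℕ} (hN : N ≤ 2 ^ n) :
    |(Nat.card {q : ℕ // q < N ∧ ∀ i, u i ≤ Int.fract (q * α i) ∧ Int.fract (q * α i) < v i} : ℝ)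
      - N * ∏ i, (v i - u i)| ≤
      thresholdConst d * t + 4 * 17 ^ d * S * heightSum d (4 ^ n) := by
  simp only [exceptional, Set.mem_union, Set.mem_iUnion, Set.mem_ofPred_eq, not_or, not_exists,
    not_le, strip] at hα
  obtain ⟨⟨⟨h0, h1⟩, h2⟩, h3⟩ := hα
  have hlin := abs_card_sub_le hn α hb N hN fun h hh hne => by
    have := (width_pos h S).trans (h0 h (Finset.mem_erase.2 ⟨hne, hh⟩))
    exact norm_pos_iff.1 this
  refine hlin.trans ?_
  have h4 := decay_sum_le h0
  have h5 : (0 : ℝ) < 17 ^ d := by positivity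
  have h6 : (0 : ℝ) ≤ 2 * 6 ^ d + 2 * d * 4 ^ d := by positivity
  have h7 : ∑ h ∈ (box d (4 ^ n)).erase 0,
      decay (height h * ‖lin h fun i => (α i : UnitAddCircle)‖) ≤
      8 * t + 4 * S * heightSum d (4 ^ n) := by linarith
  have h8 := mul_le_mul_of_nonneg_left h7 h5.le
  have h9 := mul_le_mul_of_nonneg_left h1.le h6
  rw [returnSum] at h9
  rw [thresholdConst]
  linarith

theorem exceptional_bound_le {a b c K L J p R E S m q : ℝ} (ha : 0 ≤ a) (hq : 0 ≤ q)
    (hL : 0 < L) (hJ : 1 ≤ J) (hp : 1 ≤ p) (hR : 0 ≤ R) (hRL : R ≤ a * L)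
    (hE : L * (J * p) ≤ E) (hE' : E ≤ 2 * L * (J * p)) (hS : 0 ≤ S) (hSK : S ≤ K * J)
    (hm : m ≤ b * L) (hq0 : 0 ≤ b) {ℓ : ℝ} (hℓ : 0 ≤ ℓ) (hℓp : ℓ ≤ c * p) :
    2 * R / E + (m * q + 8 * R + 4 * S * R / J) / (L * (J * p ^ 2)) +
      (128 * ℓ ^ 2 * R * E + 16 * (S * R) ^ 2 / J) / (L * (J * p ^ 2)) ^ 2 ≤
    (2 * a + b * q + 8 * a + 4 * K * a + 256 * c ^ 2 * a + 16 * (K * a) ^ 2) / (J * p) := by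
  have hJ0 : 0 < J := by linarith
  have hp0 : 0 < p := by linarith
  have hK : 0 ≤ K := by
    by_contra hcon
    nlinarith
  have hpp : p ≤ p ^ 2 := by nlinarith
  have hpp4 : p ≤ p ^ 4 := le_self_pow₀ hp (by norm_num)
  have h1 : 2 * R / E ≤ 2 * a / (J * p) := by
    calc _ ≤ 2 * (a * L) / (L * (J * p)) := by gcongr
      _ = _ := by field_simp
  have h2 : (m * q + 8 * R + 4 * S * R / J) / (L * (J * p ^ 2)) ≤
      (b * q + 8 * a + 4 * K * a) / (J * p) := by
    calc _ ≤ (b * L * q + 8 * (a * L) + 4 * (K * J) * (a * L) / J) / (L * (J * p)) := by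
          gcongr
      _ = _ := by field_simp
  have h3 : (128 * ℓ ^ 2 * R * E + 16 * (S * R) ^ 2 / J) / (L * (J * p ^ 2)) ^ 2 ≤
      (256 * c ^ 2 * a + 16 * (K * a) ^ 2) / (J * p) := by
    calc _ ≤ (128 * (c * p) ^ 2 * (a * L) * (2 * L * (J * p)) +
          16 * (K * J * (a * L)) ^ 2 / J) / (L * (J * p ^ 2)) ^ 2 := by
          have : 0 ≤ E := le_trans (by positivity) hE
          gcongr
      _ = 256 * c ^ 2 * a / (J * p) + 16 * (K * a) ^ 2 / (J * p ^ 4) := by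
          field_simp
          ring
      _ ≤ 256 * c ^ 2 * a / (J * p) + 16 * (K * a) ^ 2 / (J * p) := by gcongr
      _ = _ := by ring
  refine (add_le_add (add_le_add h1 h2) h3).trans (le_of_eq ?_)
  ring

theorem heightSum_le (d : ℕ) {n : ℕ} (hn : 1 ≤ n) :
    heightSum d (4 ^ n) ≤ 6 ^ d * (n : ℝ) ^ d := by
  refine (sum_inv_height_le d (4 ^ n)).trans ?_
  rw [← mul_pow]
  have h1 : (1 : ℝ) ≤ n := by exact_mod_cast hn
  have h2 : log ((4 ^ n : ℕ) : ℝ) = 2 * n * log 2 := by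
    push_cast
    rw [log_pow, show (4 : ℝ) = 2 ^ 2 by norm_num, log_pow]
    push_cast
    ring
  rw [h2]
  have h3 := log_two_lt_d9
  have h4 := log_two_gt_d9
  refine pow_le_pow_left₀ (by positivity) ?_ _
  nlinarith

theorem exists_two_pow_between {y : ℝ} (hy : 1 ≤ y) :
    ∃ T : ℕ, y ≤ 2 ^ T ∧ (2 : ℝ) ^ T ≤ 2 * y ∧ (T : ℝ) ≤ 2 * log y + 1 := by
  obtain ⟨k, hk, hk'⟩ := exists_nat_pow_near hy one_lt_two
  refine ⟨k + 1, hk'.le, by rw [pow_succ]; linarith, ?_⟩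
  have h1 := log_le_log (by positivity) hk
  rw [log_pow] at h1
  have h4 := log_two_gt_d9
  push_cast
  nlinarith [(Nat.cast_nonneg k : (0 : ℝ) ≤ k)]

theorem exists_exceptional_sets (d : ℕ) {δ : ℝ} (hδ : 0 < δ) :
    ∃ C : ℝ, 0 < C ∧ ∃ bad : ℕ → Set (Fin d → UnitAddCircle), ∀ j : ℕ, 1 ≤ j →
      volume.real (bad j) ≤ C / (j : ℝ) ^ (1 + δ) ∧
      ∀ α : Fin d → ℝ, (fun i => (α i : UnitAddCircle)) ∉ bad j →
        ∀ u v : Fin d → ℝ, (∀ i, 0 ≤ u i ∧ u i ≤ v i ∧ v i ≤ 1) → ∀ N : ℕ, N ≤ 2 ^ 2 ^ j →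
        |(Nat.card {q : ℕ // q < N ∧ ∀ i, u i ≤ Int.fract (q * α i) ∧
          Int.fract (q * α i) < v i} : ℝ) - N * ∏ i, (v i - u i)|
          ≤ C * ((2 : ℝ) ^ j) ^ d * (j : ℝ) ^ (1 + 2 * δ) := by
  set K : ℝ := d + 2 * (1 + δ) + 1 with hK
  have hK0 : 0 < K := by positivity
  have hT : ∀ j : ℕ, 1 ≤ j → ∃ T : ℕ, (j : ℝ) * (j : ℝ) ^ δ ≤ 2 ^ T ∧
      (2 : ℝ) ^ T ≤ 2 * ((j : ℝ) * (j : ℝ) ^ δ) ∧ (T : ℝ) ≤ (2 * (1 + δ) + 1) * j := by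
    intro j hj
    have hJ : (1 : ℝ) ≤ j := by exact_mod_cast hj
    have hp : (1 : ℝ) ≤ (j : ℝ) ^ δ := one_le_rpow hJ hδ.le
    obtain ⟨T, h1, h2, h3⟩ := exists_two_pow_between (y := (j : ℝ) * (j : ℝ) ^ δ) (by nlinarith)
    refine ⟨T, h1, h2, h3.trans ?_⟩
    rw [log_mul (by positivity) (by positivity), log_rpow (by positivity)]
    have := log_le_self (zero_le_one.trans hJ)
    nlinarith
  choose! T hT1 hT2 hT3 using hT
  set C₁ : ℝ := 2 * 6 ^ d + 2 ^ d * (1 + 2 * 4 ^ d) + 8 * 6 ^ d + 4 * K * 6 ^ d +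
    256 * (1 + 1 / δ) ^ 2 * 6 ^ d + 16 * (K * 6 ^ d) ^ 2
  set C₂ : ℝ := thresholdConst d + 4 * 17 ^ d * K * 6 ^ d
  have hC1 : 0 < C₁ := by positivity
  have hth : 0 < thresholdConst d := by
    rw [thresholdConst]
    positivity
  have hC2 : 0 < C₂ := by positivity
  refine ⟨C₁ + C₂, by positivity, fun j => exceptional d (2 ^ j) (j * d + T j)
    (((2 : ℝ) ^ j) ^ d * (j * ((j : ℝ) ^ δ) ^ 2)), fun j hj => ?_⟩
  have hJ : (1 : ℝ) ≤ j := by exact_mod_cast hj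
  have hp : (1 : ℝ) ≤ (j : ℝ) ^ δ := one_le_rpow hJ hδ.le
  have hj0 : (0 : ℝ) < j := by linarith
  set L : ℝ := ((2 : ℝ) ^ j) ^ d with hLdef
  set p : ℝ := (j : ℝ) ^ δ with hpdef
  have hL : 0 < L := by positivity
  have hS : ((j * d + T j : ℕ) : ℝ) ≤ K * j := by
    have := hT3 j hj
    push_cast
    rw [hK]
    linarith
  have hpow1 : (j : ℝ) ^ (1 + δ) = j * p := by rw [rpow_add hj0, rpow_one]
  have hpow2 : (j : ℝ) ^ (1 + 2 * δ) = j * p ^ 2 := by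
    rw [rpow_add hj0, rpow_one, mul_comm 2 δ, rpow_mul hj0.le, rpow_two]
  have hn : 1 ≤ 2 ^ j := Nat.one_le_two_pow
  have hR : heightSum d (4 ^ 2 ^ j) ≤ 6 ^ d * L := by
    have := heightSum_le d hn
    push_cast at this
    exact this
  have hR0 := heightSum_nonneg d (4 ^ 2 ^ j)
  constructor
  · rw [hpow1]
    have hE : (2 : ℝ) ^ (j * d + T j) = L * 2 ^ T j := by rw [pow_add, pow_mul]
    have hm : (((2 ^ j : ℕ) : ℝ) + 1) ^ d ≤ 2 ^ d * L := by
      rw [hLdef, ← mul_pow]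
      push_cast
      have : (1 : ℝ) ≤ 2 ^ j := one_le_pow₀ one_le_two
      gcongr
      linarith
    have hlog : 1 + log j ≤ (1 + 1 / δ) * p := by
      have := log_le_rpow_div hj0.le hδ
      rw [one_add_mul, one_div_mul_eq_div]
      exact add_le_add hp this
    have hlog0 : 0 ≤ 1 + log (j : ℝ) := by
      have := log_nonneg hJ
      linarith
    refine (measure_exceptional_le d (2 ^ j) (j * d + T j) hj (by positivity)).trans
      ((exceptional_bound_le (a := 6 ^ d) (b := 2 ^ d) (c := 1 + 1 / δ) (K := K)
        (q := 1 + 2 * 4 ^ d) (by positivity) (by positivity) hL hJ hp hR0 hR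
        ?_ ?_ (Nat.cast_nonneg _) hS hm (by positivity) hlog0 hlog).trans ?_)
    · rw [hE]
      exact mul_le_mul_of_nonneg_left (hT1 j hj) hL.le
    · rw [hE]
      have := mul_le_mul_of_nonneg_left (hT2 j hj) hL.le
      linarith
    · exact div_le_div_of_nonneg_right (le_add_of_nonneg_right hC2.le) (by positivity)
  · intro α hα u v hb N hN
    refine (abs_card_sub_le_of_notMem_exceptional hn hα hb hN).trans ?_
    rw [hpow2]
    calc _ ≤ thresholdConst d * (L * (j * p ^ 2)) + 4 * 17 ^ d * (K * j) * (6 ^ d * L) := by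
          gcongr
      _ ≤ thresholdConst d * (L * (j * p ^ 2)) + 4 * 17 ^ d * (K * (j * p ^ 2)) * (6 ^ d * L) := by
          gcongr
          exact le_mul_of_one_le_right hj0.le (one_le_pow₀ hp)
      _ = C₂ * L * (j * p ^ 2) := by ring
      _ ≤ _ := by
          gcongr
          exact le_add_of_nonneg_left hC1.le

theorem ae_exists_scale_bound (d : ℕ) {δ : ℝ} (hδ : 0 < δ) :
    ∃ C : ℝ, 0 < C ∧ ∀ᵐ α ∂((volume : Measure (Fin d → ℝ)).restrict
        (Set.univ.pi fun _ => Set.Ico (0 : ℝ) 1)), ∃ j₀ : ℕ, ∀ j : ℕ, j₀ ≤ j →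
        ∀ u v : Fin d → ℝ, (∀ i, 0 ≤ u i ∧ u i ≤ v i ∧ v i ≤ 1) → ∀ N : ℕ, N ≤ 2 ^ 2 ^ j →
        |(Nat.card {q : ℕ // q < N ∧ ∀ i, u i ≤ Int.fract ((q : ℝ) * α i) ∧
          Int.fract ((q : ℝ) * α i) < v i} : ℝ) - N * ∏ i, (v i - u i)|
          ≤ C * ((2 : ℝ) ^ j) ^ d * (j : ℝ) ^ (1 + 2 * δ) := by
  obtain ⟨C, hC, bad, hbad⟩ := exists_exceptional_sets d hδ
  refine ⟨C, hC, ?_⟩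
  have hsum : Summable fun j : ℕ => C / (((j + 1 : ℕ) : ℝ)) ^ (1 + δ) := by
    have h1 := (summable_one_div_nat_rpow (p := 1 + δ)).2 (by linarith)
    have h2 := ((summable_nat_add_iff 1).2 h1).mul_left C
    simpa only [mul_one_div] using h2
  have htsum : ∑' j, volume (bad (j + 1)) ≠ ⊤ := by
    refine ne_top_of_le_ne_top hsum.tsum_ofReal_ne_top (ENNReal.tsum_le_tsum fun j => ?_)
    rw [← ofReal_measureReal]
    exact ENNReal.ofReal_le_ofReal (hbad (j + 1) (by omega)).1
  have hmp : MeasurePreserving (fun (α : Fin d → ℝ) i => (α i : UnitAddCircle))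
      ((volume : Measure (Fin d → ℝ)).restrict (Set.univ.pi fun _ => Set.Ico (0 : ℝ) 1))
      volume := by
    rw [volume_pi, Measure.restrict_pi_pi]
    refine measurePreserving_pi _ _ fun i => ?_
    have := UnitAddCircle.measurePreserving_mk 0
    rw [zero_add, ← Measure.restrict_congr_set Ico_ae_eq_Ioc] at this
    exact this
  filter_upwards [hmp.quasiMeasurePreserving.ae (ae_eventually_notMem htsum)] with α hα
  obtain ⟨j₁, hj₁⟩ := Filter.eventually_atTop.1 hα
  refine ⟨j₁ + 1, fun j hj => ?_⟩
  have h := hj₁ (j - 1) (by omega)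
  rw [Nat.sub_add_cancel (by omega)] at h
  exact (hbad j (by omega)).2 α h

theorem disc_le {d : ℕ} {z : ℕ → Fin d → ℝ} {N : ℕ} (hN : 1 ≤ N) {E : ℝ}
    (h : ∀ u v : Fin d → ℝ, (∀ i, 0 ≤ u i ∧ u i ≤ v i ∧ v i ≤ 1) →
      |(Nat.card {q : ℕ // q < N ∧ ∀ i, u i ≤ z q i ∧ z q i < v i} : ℝ)
        - N * ∏ i, (v i - u i)| ≤ E) : disc z N ≤ E / N := by
  have hN0 : (0 : ℝ) < N := by exact_mod_cast hN
  refine csSup_le ⟨_, 0, 0, by simp, rfl⟩ ?_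
  rintro r ⟨u, v, hb, rfl⟩
  rw [le_div_iff₀ hN0]
  refine le_trans (le_of_eq ?_) (h u v hb)
  rw [← abs_of_pos hN0, ← abs_mul, abs_of_pos hN0, sub_mul, div_mul_cancel₀ _ hN0.ne', mul_comm (N : ℝ)]

theorem abs_card_sub_le_self {d : ℕ} (z : ℕ → Fin d → ℝ) (N : ℕ) {u v : Fin d → ℝ}
    (hb : ∀ i, 0 ≤ u i ∧ u i ≤ v i ∧ v i ≤ 1) :
    |(Nat.card {q : ℕ // q < N ∧ ∀ i, u i ≤ z q i ∧ z q i < v i} : ℝ)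
      - N * ∏ i, (v i - u i)| ≤ N := by
  have h1 : Nat.card {q : ℕ // q < N ∧ ∀ i, u i ≤ z q i ∧ z q i < v i} ≤ N := by
    have := Nat.card_le_card_of_injective
      (fun q : {q : ℕ // q < N ∧ ∀ i, u i ≤ z q i ∧ z q i < v i} => (⟨q.1, q.2.1⟩ : Fin N))
      fun a b hab => Subtype.ext (Fin.mk.inj_iff.1 hab)
    rwa [Nat.card_fin] at this
  have h2 : (Nat.card {q : ℕ // q < N ∧ ∀ i, u i ≤ z q i ∧ z q i < v i} : ℝ) ≤ N := by
    exact_mod_cast h1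
  have h3 : 0 ≤ ∏ i, (v i - u i) := Finset.prod_nonneg fun i _ => sub_nonneg.2 (hb i).2.1
  have h4 : ∏ i, (v i - u i) ≤ 1 :=
    Finset.prod_le_one (fun i _ => sub_nonneg.2 (hb i).2.1) fun i _ => by
      obtain ⟨h5, -, h6⟩ := hb i
      linarith
  have h5 : (0 : ℝ) ≤ N := Nat.cast_nonneg N
  have h6 : (0 : ℝ) ≤ Nat.card {q : ℕ // q < N ∧ ∀ i, u i ≤ z q i ∧ z q i < v i} :=
    Nat.cast_nonneg _
  refine abs_sub_le_of_nonneg_of_le h6 h2 (by positivity) (mul_le_of_le_one_right h5 h4)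

theorem exists_scale {N J : ℕ} (hJ : 2 ≤ J) (hN : 2 ^ 2 ^ J < N) :
    ∃ j : ℕ, J ≤ j ∧ N ≤ 2 ^ 2 ^ j ∧ (2 : ℝ) ^ j ≤ 4 * log N ∧ (j : ℝ) ≤ 6 * log (log N) := by
  have hex : ∃ j, N ≤ 2 ^ 2 ^ j :=
    ⟨N, Nat.lt_two_pow_self.le.trans (Nat.lt_two_pow_self.le)⟩
  have hspec := Nat.find_spec hex
  have hlt : J < Nat.find hex := by
    by_contra! hcon
    have h1 : 2 ^ 2 ^ Nat.find hex ≤ 2 ^ 2 ^ J :=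
      Nat.pow_le_pow_right two_pos (Nat.pow_le_pow_right two_pos hcon)
    omega
  obtain ⟨k, hk⟩ : ∃ k, Nat.find hex = k + 3 := ⟨Nat.find hex - 3, by omega⟩
  have hmin : 2 ^ 2 ^ (k + 2) < N := not_le.1 (Nat.find_min hex (by omega))
  have hlog2 : (1 / 2 : ℝ) ≤ log 2 := by linarith [log_two_gt_d9]
  have h1 : (2 : ℝ) ^ (k + 2) * log 2 ≤ log N := by
    have : log ((2 ^ 2 ^ (k + 2) : ℕ) : ℝ) ≤ log N :=
      log_le_log (by positivity) (by exact_mod_cast hmin.le)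
    push_cast at this
    rwa [log_pow, Nat.cast_pow, Nat.cast_two] at this
  have h2 : (2 : ℝ) ^ (k + 1) ≤ log N := by
    refine le_trans ?_ h1
    rw [pow_succ _ (k + 1)]
    have : (0 : ℝ) < 2 ^ (k + 1) := by positivity
    nlinarith
  have h3 : ((k + 1 : ℕ) : ℝ) * log 2 ≤ log (log N) := by
    rw [← log_pow]
    exact log_le_log (by positivity) h2
  refine ⟨Nat.find hex, hlt.le, hspec, ?_, ?_⟩
  · rw [hk, pow_add]
    rw [pow_succ] at h2
    linarith
  · rw [hk]
    push_cast at h3 ⊢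
    nlinarith [(Nat.cast_nonneg k : (0 : ℝ) ≤ k)]

theorem one_lt_log {N : ℕ} (hN : 3 ≤ N) : 1 < log (N : ℝ) := by
  have : (3 : ℝ) ≤ N := by exact_mod_cast hN
  rw [lt_log_iff_exp_lt (by linarith)]
  linarith [exp_one_lt_three]

end KroneckerDisc


theorem stmt0 (d : ℕ) (hd : 1 ≤ d) (ε : ℝ) (hε : 0 < ε) :
    ∀ᵐ α ∂((volume : Measure (Fin d → ℝ)).restrict
        (Set.univ.pi fun _ => Set.Ico (0 : ℝ) 1)),
      ∃ C > 0, ∀ N : ℕ, 3 ≤ N →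
        disc (fun n i => Int.fract (n * α i)) N
          ≤ C * Real.log N ^ d * Real.log (Real.log N) ^ ((1 : ℝ) + ε) / N := by
  obtain ⟨C, hC, hae⟩ := KroneckerDisc.ae_exists_scale_bound d (half_pos hε)
  filter_upwards [hae] with α hα
  obtain ⟨j₀, hj₀⟩ := hα
  rw [mul_div_cancel₀ ε two_ne_zero] at hj₀
  set J := max j₀ 2
  have h3 : 1 < log (3 : ℕ) := KroneckerDisc.one_lt_log le_rfl
  have hll3 : 0 < log (log (3 : ℕ)) := log_pos h3
  set D : ℝ := log (3 : ℕ) ^ d * log (log (3 : ℕ)) ^ (1 + ε)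
  have hD : 0 < D := by positivity
  have h6 : (0 : ℝ) < 6 ^ (1 + ε) := by positivity
  refine ⟨C * 4 ^ d * 6 ^ (1 + ε) + 2 ^ 2 ^ J / D, by positivity, fun N hN => ?_⟩
  have hlogN := KroneckerDisc.one_lt_log hN
  have hllN : 0 < log (log N) := log_pos hlogN
  have hmain : ∀ E : ℝ, (∀ u v : Fin d → ℝ, (∀ i, 0 ≤ u i ∧ u i ≤ v i ∧ v i ≤ 1) →
      |(Nat.card {q : ℕ // q < N ∧ ∀ i, u i ≤ Int.fract (q * α i) ∧
        Int.fract (q * α i) < v i} : ℝ) - N * ∏ i, (v i - u i)| ≤ E) →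
      E ≤ (C * 4 ^ d * 6 ^ (1 + ε) + 2 ^ 2 ^ J / D) * log N ^ d * log (log N) ^ (1 + ε) →
      disc (fun n i => Int.fract (n * α i)) N ≤
        (C * 4 ^ d * 6 ^ (1 + ε) + 2 ^ 2 ^ J / D) * log N ^ d * log (log N) ^ (1 + ε) / N :=
    fun E h1 h2 => (KroneckerDisc.disc_le (z := fun n i => Int.fract (n * α i)) (by omega) h1).trans
      (div_le_div_of_nonneg_right h2 (Nat.cast_nonneg N))
  rcases le_or_gt N (2 ^ 2 ^ J) with hle | hlt
  · refine hmain N (fun u v hb =>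
      KroneckerDisc.abs_card_sub_le_self (fun n i => Int.fract (n * α i)) N hb) ?_
    have h3N : log (3 : ℕ) ≤ log N := log_le_log (by norm_num) (by exact_mod_cast hN)
    have hDN : D ≤ log N ^ d * log (log N) ^ (1 + ε) := by
      change log (3 : ℕ) ^ d * log (log (3 : ℕ)) ^ (1 + ε) ≤ _
      have := log_le_log (by linarith) h3N
      gcongr
    calc (N : ℝ) ≤ 2 ^ 2 ^ J := by exact_mod_cast hle
      _ = 2 ^ 2 ^ J / D * D := by field_simp
      _ ≤ (C * 4 ^ d * 6 ^ (1 + ε) + 2 ^ 2 ^ J / D) *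
          (log N ^ d * log (log N) ^ (1 + ε)) := by
        gcongr
        exact le_add_of_nonneg_left (by positivity)
      _ = _ := by ring
  · obtain ⟨j, hj, hNj, h1, h2⟩ := KroneckerDisc.exists_scale (le_max_right j₀ 2) hlt
    refine hmain _ (fun u v hb => hj₀ j ((le_max_left _ _).trans hj) u v hb N hNj) ?_
    calc _ ≤ C * (4 * log N) ^ d * (6 * log (log N)) ^ (1 + ε) := by gcongr
      _ = C * 4 ^ d * 6 ^ (1 + ε) * (log N ^ d * log (log N) ^ (1 + ε)) := by
        rw [mul_pow, mul_rpow (by norm_num) hllN.le]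
        ring
      _ ≤ (C * 4 ^ d * 6 ^ (1 + ε) + 2 ^ 2 ^ J / D) *
          (log N ^ d * log (log N) ^ (1 + ε)) := by
        gcongr
        exact le_add_of_nonneg_right (by positivity)
      _ = _ := by ring
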